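/- Let p ≥ 3 and (β,h) be a p-critical point, let m be any global maximizer of H = H_{β,h,p} (so m ∈ (−1,1) and H''(m) < 0), and let A be an open neighborhood of m whose closure contains no other global maximizer of H. Then there exist constants C > 0 and C' > 0 such that for all N large enough, for both r ∈ {0,1}, and for all x ∈ [0, C·N^{1/6}], | P( (−1)^r (S_N − N m)/√(−N/H''(m)) > x | S_N/N ∈ A ) / (1 − Φ(x)) − 1 | ≤ C'(1 + x^3)·N^{−1/2}. -/

import Mathlib

open Real MeasureTheory Filter
open scoped BigOperators Topology

noncomputable section

/-- The spin value (`±1`) of a Boolean coordinate. -/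
def spin (b : Bool) : ℝ := if b then 1 else -1

/-- The total magnetization `S_N = ∑ᵢ Xᵢ` of a configuration. -/
def mag {N : ℕ} (x : Fin N → Bool) : ℝ := ∑ i, spin (x i)

/-- The Hamiltonian of the `p`-spin Curie-Weiss model:
`β N^{1-p} ∑_{i₁,…,i_p} x_{i₁} ⋯ x_{i_p} + h ∑ᵢ xᵢ`. -/
def cwHamiltonian (p N : ℕ) (β h : ℝ) (x : Fin N → Bool) : ℝ :=
  β * (N : ℝ) ^ ((1 : ℤ) - (p : ℤ)) * (∑ i : Fin p → Fin N, ∏ j, spin (x (i j)))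
    + h * mag x

/-- The (unnormalized) Gibbs weight of a configuration. -/
def cwWeight (p N : ℕ) (β h : ℝ) (x : Fin N → Bool) : ℝ :=
  Real.exp (cwHamiltonian p N β h x)

/-- The probability of an event `E` under the `p`-spin Curie-Weiss measure `P_{β,h,p}`. -/
def cwProb (p N : ℕ) (β h : ℝ) (E : Set (Fin N → Bool)) : ℝ :=
  (∑ x : Fin N → Bool, E.indicator (cwWeight p N β h) x) /
    ∑ x : Fin N → Bool, cwWeight p N β h x

/-- Conditional probability of `E` given `A` under the `p`-spin Curie-Weiss measure. -/
def cwCondProb (p N : ℕ) (β h : ℝ) (E A : Set (Fin N → Bool)) : ℝ :=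
  cwProb p N β h (E ∩ A) / cwProb p N β h A

/-- The binary entropy function `I(x) = ½[(1+x)log(1+x) + (1-x)log(1-x)]`. -/
def binEnt (x : ℝ) : ℝ := (1/2) * ((1+x) * Real.log (1+x) + (1-x) * Real.log (1-x))

/-- The function `H_{β,h,p}(x) = βxᵖ + hx - I(x)`. -/
def Hfun (p : ℕ) (β h : ℝ) (x : ℝ) : ℝ := β * x ^ p + h * x - binEnt x

/-- `m` is a global maximizer of `H_{β,h,p}` on `[-1,1]`, lying in `(-1,1)`. -/
def isMaximizer (p : ℕ) (β h m : ℝ) : Prop :=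
  m ∈ Set.Ioo (-1 : ℝ) 1 ∧ ∀ x ∈ Set.Icc (-1 : ℝ) 1, Hfun p β h x ≤ Hfun p β h m

/-- `m` is the unique global maximizer of `H_{β,h,p}`. -/
def isUniqueMaximizer (p : ℕ) (β h m : ℝ) : Prop :=
  isMaximizer p β h m ∧ ∀ m', isMaximizer p β h m' → m' = m

/-- `(β,h)` is a `p`-regular point with unique global maximizer `m`. -/
def pRegular (p : ℕ) (β h m : ℝ) : Prop :=
  isUniqueMaximizer p β h m ∧ iteratedDeriv 2 (Hfun p β h) m < 0

/-- `(β,h)` is a `p`-special point with unique global maximizer `m`. -/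
def pSpecial (p : ℕ) (β h m : ℝ) : Prop :=
  isUniqueMaximizer p β h m ∧ iteratedDeriv 2 (Hfun p β h) m = 0

/-- `(β,h)` is a `p`-critical point: `H_{β,h,p}` has more than one global maximizer. -/
def pCritical (p : ℕ) (β h : ℝ) : Prop :=
  ∃ m₁ m₂, m₁ ≠ m₂ ∧ isMaximizer p β h m₁ ∧ isMaximizer p β h m₂

/-- The probability assigned to a set `S ⊆ ℝ` by the centered Gaussian with variance `v`. -/
def gaussProb (v : ℝ) (S : Set ℝ) : ℝ :=
  ∫ t in S, (Real.sqrt (2 * Real.pi * v))⁻¹ * Real.exp (-t ^ 2 / (2 * v))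

/-- The CDF of the centered Gaussian with variance `v`. -/
def gaussCDF (v x : ℝ) : ℝ := gaussProb v (Set.Iic x)

/-- The standard normal CDF `Φ`. -/
def stdNormCDF (x : ℝ) : ℝ := gaussCDF 1 x

/-- The CDF of the limit law `F` at a `p`-special point, where `c = H⁽⁴⁾(m_*)`:
`dF(x) = (2/Γ(1/4)) (-c/24)^{1/4} exp(c x⁴/24) dx`. -/
def specialCDF (c x : ℝ) : ℝ :=
  ∫ t in Set.Iic x, (2 / Real.Gamma (1/4)) * ((-c) / 24) ^ ((1:ℝ)/4) * Real.exp (c * t ^ 4 / 24)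

/-- The inverse hyperbolic tangent `tanh⁻¹(t) = ½ log((1+t)/(1-t))`. -/
def arctanh (t : ℝ) : ℝ := (1/2) * Real.log ((1+t)/(1-t))

/-- The function `g(t) = tanh⁻¹(t)/(p t^{p-1})`, so that the maximum pseudolikelihood
estimate of `β` is `g(X̄)`. -/
def gMPL (p : ℕ) (t : ℝ) : ℝ := arctanh t / (p * t ^ (p - 1))

/-- The threshold `β*(p) = inf{β ≥ 0 : sup_{x∈[0,1]} H_{β,0,p}(x) > 0}`. -/
def betaStar (p : ℕ) : ℝ := sInf {b : ℝ | 0 ≤ b ∧ ∃ x ∈ Set.Icc (0:ℝ) 1, 0 < Hfun p b 0 x}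

/-! ### Gaussian tails -/

/-- The unnormalized Gaussian tail `∫_x^∞ exp (-t²/2) dt`. -/
def gaussTail (x : ℝ) : ℝ := ∫ t in Set.Ioi x, Real.exp (-t ^ 2 / 2)

lemma integrable_exp_neg_sq_half : Integrable (fun t : ℝ => Real.exp (-t ^ 2 / 2)) := by
  have := integrable_exp_neg_mul_sq (b := 1 / 2) (by norm_num)
  refine this.congr (Eventually.of_forall fun t => ?_)
  simp only
  ring_nf

lemma integral_exp_neg_sq_half : ∫ t : ℝ, Real.exp (-t ^ 2 / 2) = √(2 * π) := by
  have := integral_gaussian (1 / 2)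
  rw [show π / (1 / 2) = 2 * π by ring] at this
  rw [← this]
  congr 1
  ext t
  ring_nf

lemma gaussTail_zero : gaussTail 0 = √(2 * π) / 2 := by
  have := integral_gaussian_Ioi (1 / 2)
  rw [show π / (1 / 2) = 2 * π by ring] at this
  rw [← this, gaussTail]
  congr 1
  ext t
  ring_nf

lemma one_sub_stdNormCDF (x : ℝ) : 1 - stdNormCDF x = gaussTail x / √(2 * π) := by
  have h0 : √(2 * π) ≠ 0 := by positivity
  have h1 : stdNormCDF x = (√(2 * π))⁻¹ * ∫ t in Set.Iic x, Real.exp (-t ^ 2 / 2) := by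
    simp only [stdNormCDF, gaussCDF, gaussProb, mul_one]
    rw [integral_const_mul]
  have h2 := intervalIntegral.integral_Iic_add_Ioi (b := x)
    (integrable_exp_neg_sq_half.integrableOn) (integrable_exp_neg_sq_half.integrableOn)
  rw [integral_exp_neg_sq_half] at h2
  rw [h1, gaussTail, eq_div_iff h0, sub_mul, one_mul, mul_right_comm, inv_mul_cancel₀ h0]
  linarith

/-- A lower bound of Mills ratio type. -/
lemma exp_le_gaussTail {x : ℝ} (hx : 0 ≤ x) :
    Real.exp (-x ^ 2 / 2) ≤ 3 * (1 + x) * gaussTail x := by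
  have hx1 : 0 < 1 + x := by linarith
  set d := (1 + x)⁻¹ with hd
  have hdpos : 0 < d := by positivity
  have hdx : d * (1 + x) = 1 := inv_mul_cancel₀ hx1.ne'
  have h1 : ∫ t in Set.Ioc x (x + d), Real.exp (-x ^ 2 / 2) * Real.exp (-1) ≤
      ∫ t in Set.Ioc x (x + d), Real.exp (-t ^ 2 / 2) := by
    refine setIntegral_mono_on (integrableOn_const (by simp))
      integrable_exp_neg_sq_half.integrableOn measurableSet_Ioc fun t ht => ?_
    rw [← Real.exp_add]
    refine Real.exp_le_exp.2 ?_
    have h3 : t ^ 2 ≤ (x + d) ^ 2 := pow_le_pow_left₀ (by linarith [ht.1]) ht.2 2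
    have h4 : d ≤ 1 := by nlinarith
    nlinarith
  have h2 : ∫ t in Set.Ioc x (x + d), Real.exp (-t ^ 2 / 2) ≤ gaussTail x :=
    setIntegral_mono_set integrable_exp_neg_sq_half.integrableOn
      (Eventually.of_forall fun t => (Real.exp_pos _).le)
      (Set.Ioc_subset_Ioi_self.eventuallyLE)
  rw [setIntegral_const] at h1
  simp only [measureReal_def, Real.volume_Ioc, add_sub_cancel_left, ENNReal.toReal_ofReal hdpos.le,
    smul_eq_mul] at h1
  have h3 : (1 / 3 : ℝ) ≤ Real.exp (-1) := by
    rw [Real.exp_neg, one_div]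
    exact inv_anti₀ (Real.exp_pos _) (by linarith [Real.exp_one_lt_d9])
  have h5 : d * (Real.exp (-x ^ 2 / 2) * (1 / 3)) ≤ gaussTail x :=
    le_trans (by gcongr) (h1.trans h2)
  calc Real.exp (-x ^ 2 / 2)
      = 3 * (1 + x) * (d * (Real.exp (-x ^ 2 / 2) * (1 / 3))) := by
        linear_combination (-Real.exp (-x ^ 2 / 2)) * hdx
    _ ≤ _ := by gcongr

lemma gaussTail_pos {x : ℝ} (hx : 0 ≤ x) : 0 < gaussTail x := by
  by_contra hc
  have := exp_le_gaussTail hx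
  nlinarith [Real.exp_pos (-x ^ 2 / 2), mul_nonneg (show 0 ≤ 3 * (1 + x) by linarith)
    (neg_nonneg.2 (not_lt.1 hc))]

lemma tendsto_pow_mul_exp_neg_sq_half (n : ℕ) :
    Tendsto (fun t : ℝ => t ^ n * Real.exp (-t ^ 2 / 2)) atTop (𝓝 0) := by
  refine squeeze_zero' ((eventually_ge_atTop 0).mono fun t ht => by positivity) ?_
    (Real.tendsto_pow_mul_exp_neg_atTop_nhds_zero n)
  filter_upwards [eventually_ge_atTop 2] with t ht
  gcongr
  nlinarith

lemma hasDerivAt_exp_neg_sq_half (t : ℝ) :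
    HasDerivAt (fun t : ℝ => Real.exp (-t ^ 2 / 2)) (-t * Real.exp (-t ^ 2 / 2)) t := by
  have h : HasDerivAt (fun t : ℝ => -t ^ 2 / 2) (-t) t := by
    have := ((hasDerivAt_pow 2 t).neg).div_const 2
    convert! this using 1
    push_cast
    ring
  convert! h.exp using 1
  ring

lemma gaussTail_le {x : ℝ} (hx : 1 ≤ x) : gaussTail x ≤ Real.exp (-x ^ 2 / 2) := by
  have hd : ∀ t ∈ Set.Ici x, HasDerivAt (fun t : ℝ => -Real.exp (-t ^ 2 / 2))
      (t * Real.exp (-t ^ 2 / 2)) t := fun t _ => by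
    convert! (hasDerivAt_exp_neg_sq_half t).neg using 1
    ring
  have hlim : Tendsto (fun t : ℝ => -Real.exp (-t ^ 2 / 2)) atTop (𝓝 0) := by
    simpa using (tendsto_pow_mul_exp_neg_sq_half 0).neg
  have hnn : ∀ t ∈ Set.Ioi x, 0 ≤ t * Real.exp (-t ^ 2 / 2) := fun t ht =>
    mul_nonneg (by linarith [Set.mem_Ioi.1 ht]) (Real.exp_pos _).le
  have hint := integrableOn_Ioi_deriv_of_nonneg' hd hnn hlim
  have heq := integral_Ioi_of_hasDerivAt_of_nonneg' hd hnn hlim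
  calc gaussTail x ≤ ∫ t in Set.Ioi x, t * Real.exp (-t ^ 2 / 2) := by
        refine setIntegral_mono_on integrable_exp_neg_sq_half.integrableOn hint
          measurableSet_Ioi fun t ht => ?_
        have := Set.mem_Ioi.1 ht
        nlinarith [Real.exp_pos (-t ^ 2 / 2)]
    _ = Real.exp (-x ^ 2 / 2) := by rw [heq]; ring

lemma integral_cube_mul_gauss {x : ℝ} (hx : 0 ≤ x) :
    IntegrableOn (fun t : ℝ => t ^ 3 * Real.exp (-t ^ 2 / 2)) (Set.Ioi x) ∧
    ∫ t in Set.Ioi x, t ^ 3 * Real.exp (-t ^ 2 / 2) = (x ^ 2 + 2) * Real.exp (-x ^ 2 / 2) := by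
  have hd : ∀ t ∈ Set.Ici x, HasDerivAt (fun t : ℝ => -((t ^ 2 + 2) * Real.exp (-t ^ 2 / 2)))
      (t ^ 3 * Real.exp (-t ^ 2 / 2)) t := fun t _ => by
    convert! (((hasDerivAt_pow 2 t).add_const 2).mul (hasDerivAt_exp_neg_sq_half t)).neg using 1
    push_cast
    ring
  have hlim : Tendsto (fun t : ℝ => -((t ^ 2 + 2) * Real.exp (-t ^ 2 / 2))) atTop (𝓝 0) := by
    have := ((tendsto_pow_mul_exp_neg_sq_half 2).add
      ((tendsto_pow_mul_exp_neg_sq_half 0).const_mul 2)).neg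
    simp only [mul_zero, add_zero, neg_zero] at this
    refine this.congr fun t => ?_
    ring
  have hnn : ∀ t ∈ Set.Ioi x, 0 ≤ t ^ 3 * Real.exp (-t ^ 2 / 2) := fun t ht =>
    mul_nonneg (pow_nonneg (by linarith [Set.mem_Ioi.1 ht]) 3) (Real.exp_pos _).le
  refine ⟨integrableOn_Ioi_deriv_of_nonneg' hd hnn hlim, ?_⟩
  rw [integral_Ioi_of_hasDerivAt_of_nonneg' hd hnn hlim]
  ring

lemma integrableOn_one_add_cube_gauss {x : ℝ} (hx : 0 ≤ x) :
    IntegrableOn (fun t : ℝ => (1 + t ^ 3) * Real.exp (-t ^ 2 / 2)) (Set.Ioi x) := by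
  refine (integrable_exp_neg_sq_half.integrableOn.add (integral_cube_mul_gauss hx).1).congr_fun
    (fun t _ => ?_) measurableSet_Ioi
  simp only [Pi.add_apply]
  ring

lemma integral_one_add_cube_gauss_le {x : ℝ} (hx : 0 ≤ x) :
    ∫ t in Set.Ioi x, (1 + t ^ 3) * Real.exp (-t ^ 2 / 2) ≤ 16 * (1 + x ^ 3) * gaussTail x := by
  have h1 : ∫ t in Set.Ioi x, (1 + t ^ 3) * Real.exp (-t ^ 2 / 2) =
      gaussTail x + (x ^ 2 + 2) * Real.exp (-x ^ 2 / 2) := by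
    rw [← (integral_cube_mul_gauss hx).2, gaussTail,
      ← integral_add integrable_exp_neg_sq_half.integrableOn (integral_cube_mul_gauss hx).1]
    congr 1
    ext t
    ring
  have hG := gaussTail_pos hx
  have h2 : (x ^ 2 + 2) * Real.exp (-x ^ 2 / 2) ≤ (x ^ 2 + 2) * (3 * (1 + x) * gaussTail x) := by
    gcongr
    exact exp_le_gaussTail hx
  have h3 : (x ^ 2 + 2) * (1 + x) ≤ 5 * (1 + x ^ 3) := by
    nlinarith [mul_nonneg hx (sq_nonneg (x - 1)), sq_nonneg (x - 1)]
  rw [h1]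
  nlinarith [mul_le_mul_of_nonneg_right h3 hG.le, pow_nonneg hx 3,
    mul_nonneg (pow_nonneg hx 3) hG.le]

/-! ### Comparing lattice sums with integrals -/

lemma mul_sum_le_setIntegral {ι : Type*} {s : Finset ι} {f y : ι → ℝ} {δ x : ℝ} {F : ℝ → ℝ}
    (hδ : 0 < δ) (hsep : ∀ i ∈ s, ∀ j ∈ s, i ≠ j → δ ≤ |y i - y j|)
    (hF0 : ∀ t ∈ Set.Ioi x, 0 ≤ F t) (hF : IntegrableOn F (Set.Ioi x))
    (hx : ∀ k ∈ s, x ≤ y k)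
    (hfF : ∀ k ∈ s, ∀ t ∈ Set.Ioc (y k) (y k + δ), f k ≤ F t) :
    δ * ∑ k ∈ s, f k ≤ ∫ t in Set.Ioi x, F t := by
  have hdisj : Set.Pairwise (↑s) (Function.onFun Disjoint fun k => Set.Ioc (y k) (y k + δ)) := by
    intro i hi j hj hij
    have := hsep i hi j hj hij
    refine Set.disjoint_left.2 fun t ht ht' => ?_
    rcases le_abs.1 this with h | h <;> linarith [ht.1, ht.2, ht'.1, ht'.2]
  have hsub : ∀ k ∈ s, Set.Ioc (y k) (y k + δ) ⊆ Set.Ioi x := fun k hk t ht =>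
    lt_of_le_of_lt (hx k hk) ht.1
  calc δ * ∑ k ∈ s, f k = ∑ k ∈ s, ∫ t in Set.Ioc (y k) (y k + δ), f k := by
        rw [Finset.mul_sum]
        refine Finset.sum_congr rfl fun k _ => ?_
        rw [setIntegral_const]
        simp [measureReal_def, ENNReal.toReal_ofReal hδ.le]
    _ ≤ ∑ k ∈ s, ∫ t in Set.Ioc (y k) (y k + δ), F t := by
        refine Finset.sum_le_sum fun k hk => ?_
        exact setIntegral_mono_on (by simp) (hF.mono_set (hsub k hk)) measurableSet_Ioc (hfF k hk)
    _ = ∫ t in ⋃ k ∈ s, Set.Ioc (y k) (y k + δ), F t :=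
        (integral_biUnion_finset s (fun _ _ => measurableSet_Ioc) hdisj
          fun k hk => hF.mono_set (hsub k hk)).symm
    _ ≤ ∫ t in Set.Ioi x, F t := by
        refine setIntegral_mono_set hF ?_ (Set.iUnion₂_subset hsub).eventuallyLE
        exact (ae_restrict_iff' measurableSet_Ioi).2 (Eventually.of_forall hF0)

lemma setIntegral_le_mul_sum {ι : Type*} {s : Finset ι} {f y : ι → ℝ} {δ : ℝ} {F : ℝ → ℝ}
    {S : Set ℝ} (hS : MeasurableSet S) (hδ : 0 < δ) (hf : ∀ k ∈ s, 0 ≤ f k)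
    (hF : IntegrableOn F S)
    (hcov : ∀ t ∈ S, ∃ k ∈ s, t ∈ Set.Ioc (y k - δ) (y k) ∧ F t ≤ f k) :
    ∫ t in S, F t ≤ δ * ∑ k ∈ s, f k := by
  have hint : ∀ k ∈ s, Integrable ((Set.Ioc (y k - δ) (y k)).indicator fun _ => f k) := fun k _ =>
    (integrable_indicator_iff measurableSet_Ioc).2 (by simp)
  have hnn : ∀ k ∈ s, ∀ t, 0 ≤ (Set.Ioc (y k - δ) (y k)).indicator (fun _ => f k) t :=
    fun k hk t => Set.indicator_nonneg (fun _ _ => hf k hk) t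
  calc ∫ t in S, F t
      ≤ ∫ t in S, ∑ k ∈ s, (Set.Ioc (y k - δ) (y k)).indicator (fun _ => f k) t := by
        refine setIntegral_mono_on hF (integrable_finsetSum s hint).integrableOn hS
          fun t ht => ?_
        obtain ⟨k, hk, htk, hle⟩ := hcov t ht
        refine hle.trans ?_
        have := Finset.single_le_sum (fun i hi => hnn i hi t) hk
        rwa [Set.indicator_of_mem htk] at this
    _ ≤ ∫ t, ∑ k ∈ s, (Set.Ioc (y k - δ) (y k)).indicator (fun _ => f k) t :=
        setIntegral_le_integral (integrable_finsetSum s hint)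
          (Eventually.of_forall fun t => Finset.sum_nonneg fun k hk => hnn k hk t)
    _ = δ * ∑ k ∈ s, f k := by
        rw [integral_finsetSum s hint, Finset.mul_sum]
        refine Finset.sum_congr rfl fun k _ => ?_
        rw [integral_indicator measurableSet_Ioc, setIntegral_const]
        simp [measureReal_def, ENNReal.toReal_ofReal hδ.le]

/-! ### Moderate deviations for lattice sums with almost Gaussian weights -/

lemma eventually_mul_pow_le_exp_mul_sq (K : ℝ) (n : ℕ) {a : ℝ} (ha : 0 < a) :
    ∀ᶠ R : ℝ in atTop, K * R ^ n ≤ Real.exp (a * R ^ 2) := by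
  have h := (isLittleO_pow_exp_pos_mul_atTop n ha).const_mul_left K
  filter_upwards [h.bound one_pos, eventually_ge_atTop 1] with R hR hR1
  rw [one_mul, Real.norm_eq_abs, Real.norm_eq_abs, abs_of_pos (Real.exp_pos _)] at hR
  refine (le_abs_self _).trans (hR.trans (Real.exp_le_exp.2 ?_))
  exact mul_le_mul_of_nonneg_left (by nlinarith) ha.le

lemma exp_sub_gauss_le {D κ R y t f : ℝ} (hD : 0 < D) (hκ : 0 < κ) (hR : 1 ≤ R)
    (hκR : 3 * κ ≤ R ^ 2) (hy0 : 0 ≤ y) (hyR : y ≤ 2 * R)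
    (hf : |f - Real.exp (-y ^ 2 / 2)| ≤ D * (1 + y ^ 3) / R ^ 3 * Real.exp (-y ^ 2 / 2))
    (ht : t ∈ Set.Ioc y (y + κ / R ^ 3)) :
    f ≤ Real.exp (-t ^ 2 / 2) +
      (2 * κ + 3 * D) / R ^ 3 * ((1 + t ^ 3) * Real.exp (-t ^ 2 / 2)) := by
  have hR3 : 0 < R ^ 3 := by positivity
  have hδ : κ / R ^ 3 ≤ R := by
    rw [div_le_iff₀ hR3]
    nlinarith [pow_pos (by linarith : 0 < R) 2]
  have ht0 : 0 ≤ t := hy0.trans ht.1.le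
  set a := κ / R ^ 3 * t with ha
  have ha0 : 0 ≤ a := by positivity
  have ha1 : a ≤ 1 := by
    rw [ha, div_mul_eq_mul_div, div_le_one hR3]
    nlinarith [ht.2]
  have hexp : Real.exp (-y ^ 2 / 2) ≤ Real.exp (-t ^ 2 / 2) * (1 + 2 * a) := by
    calc Real.exp (-y ^ 2 / 2) ≤ Real.exp (-t ^ 2 / 2 + a) := by
          refine Real.exp_le_exp.2 ?_
          nlinarith [ht.1, ht.2]
      _ = Real.exp (-t ^ 2 / 2) * Real.exp a := Real.exp_add _ _
      _ ≤ _ := by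
          gcongr
          have := (abs_le.1 (Real.abs_exp_sub_one_le (abs_le.2 ⟨by linarith, ha1⟩))).2
          rw [abs_of_nonneg ha0] at this
          linarith
  set ψ := D * (1 + t ^ 3) / R ^ 3 with hψ
  have hψ0 : 0 ≤ ψ := by positivity
  have hψy : D * (1 + y ^ 3) / R ^ 3 ≤ ψ := by
    rw [hψ]
    gcongr
    exact ht.1.le
  have ht3 : t ≤ 1 + t ^ 3 := by nlinarith [sq_nonneg (t - 1), mul_nonneg ht0 (sq_nonneg (t - 1))]
  have haψ : a ≤ κ / R ^ 3 * (1 + t ^ 3) := by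
    rw [ha]
    gcongr
  have e := Real.exp_pos (-t ^ 2 / 2)
  calc f ≤ Real.exp (-y ^ 2 / 2) * (1 + D * (1 + y ^ 3) / R ^ 3) := by
        linarith [(abs_le.1 hf).2]
    _ ≤ (Real.exp (-t ^ 2 / 2) * (1 + 2 * a)) * (1 + ψ) := by gcongr
    _ = Real.exp (-t ^ 2 / 2) * (1 + 2 * a + ψ + 2 * (a * ψ)) := by ring
    _ ≤ Real.exp (-t ^ 2 / 2) * (1 + 2 * (κ / R ^ 3 * (1 + t ^ 3)) + 3 * ψ) := by
        gcongr ?_ * ?_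
        nlinarith
    _ = _ := by rw [hψ]; ring

lemma gauss_sub_exp_le {D κ R y t f : ℝ} (hD : 0 < D) (hκ : 0 < κ) (hR : 1 ≤ R)
    (hκR : 3 * κ ≤ R ^ 2) (ht0 : 0 ≤ t)
    (hf : |f - Real.exp (-y ^ 2 / 2)| ≤ D * (1 + y ^ 3) / R ^ 3 * Real.exp (-y ^ 2 / 2))
    (ht : t ∈ Set.Ioc (y - κ / R ^ 3) y) :
    Real.exp (-t ^ 2 / 2) -
      (2 * κ + 5 * D) / R ^ 3 * ((1 + t ^ 3) * Real.exp (-t ^ 2 / 2)) ≤ f := by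
  have hR3 : 0 < R ^ 3 := by positivity
  set δ := κ / R ^ 3 with hδdef
  have hδ0 : 0 < δ := by positivity
  have hδ : δ ≤ 1 := by
    rw [hδdef, div_le_one hR3]
    nlinarith [pow_pos (by linarith : 0 < R) 2]
  have ht1 := ht.1
  have hty := ht.2
  set a := δ * (1 + t) with ha
  have ha0 : 0 ≤ a := by positivity
  have e := Real.exp_pos (-t ^ 2 / 2)
  have hexp : Real.exp (-t ^ 2 / 2) * (1 - a) ≤ Real.exp (-y ^ 2 / 2) := by
    calc Real.exp (-t ^ 2 / 2) * (1 - a) ≤ Real.exp (-t ^ 2 / 2) * Real.exp (-a) := by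
          gcongr
          linarith [Real.add_one_le_exp (-a)]
      _ = Real.exp (-t ^ 2 / 2 + -a) := (Real.exp_add _ _).symm
      _ ≤ _ := by
          refine Real.exp_le_exp.2 ?_
          nlinarith
  have hexp' : Real.exp (-y ^ 2 / 2) ≤ Real.exp (-t ^ 2 / 2) := by
    refine Real.exp_le_exp.2 ?_
    nlinarith
  set ψ := D * (1 + y ^ 3) / R ^ 3 with hψ
  have hψ0 : 0 ≤ ψ := by
    have : 0 ≤ y := ht0.trans hty
    positivity
  have hψt : ψ ≤ 5 * D / R ^ 3 * (1 + t ^ 3) := by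
    have hy3 : y ^ 3 ≤ (t + 1) ^ 3 := pow_le_pow_left₀ (ht0.trans hty) (by linarith) 3
    have : 1 + y ^ 3 ≤ 5 * (1 + t ^ 3) := by
      nlinarith [sq_nonneg (t - 1), mul_nonneg ht0 (sq_nonneg (t - 1)), pow_nonneg ht0 3]
    calc ψ ≤ D * (5 * (1 + t ^ 3)) / R ^ 3 := by rw [hψ]; gcongr
      _ = _ := by ring
  have haψ : a ≤ 2 * κ / R ^ 3 * (1 + t ^ 3) := by
    have ht3 : 1 + t ≤ 2 * (1 + t ^ 3) := by
      nlinarith [sq_nonneg (t - 1), mul_nonneg ht0 (sq_nonneg (t - 1))]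
    calc a ≤ δ * (2 * (1 + t ^ 3)) := by rw [ha]; gcongr
      _ = _ := by rw [hδdef]; ring
  calc Real.exp (-t ^ 2 / 2) -
        (2 * κ + 5 * D) / R ^ 3 * ((1 + t ^ 3) * Real.exp (-t ^ 2 / 2))
      = Real.exp (-t ^ 2 / 2) *
          (1 - 2 * κ / R ^ 3 * (1 + t ^ 3) - 5 * D / R ^ 3 * (1 + t ^ 3)) := by ring
    _ ≤ Real.exp (-t ^ 2 / 2) * (1 - a - ψ) := by
        gcongr
    _ ≤ Real.exp (-y ^ 2 / 2) * (1 - ψ) := by nlinarith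
    _ ≤ f := by linarith [(abs_le.1 hf).1]

set_option maxHeartbeats 1000000 in
theorem moderate_tail_bounds {D κ c E : ℝ} (hD : 0 < D) (hκ : 0 < κ) (hc : 0 < c) (hE : 0 < E) :
    ∃ C : ℝ, 0 < C ∧ ∃ C' : ℝ, 0 < C' ∧ ∀ᶠ R : ℝ in atTop, ∀ (s : Finset ℕ) (f y : ℕ → ℝ),
      (s.card : ℝ) ≤ R ^ 6 + 1 → (∀ k ∈ s, 0 ≤ f k) →
      (∀ i ∈ s, ∀ j ∈ s, i ≠ j → κ / R ^ 3 ≤ |y i - y j|) →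
      (∀ t ∈ Set.Ioc 0 R, ∃ k ∈ s, t ∈ Set.Ioc (y k - κ / R ^ 3) (y k)) →
      (∀ k ∈ s, 0 ≤ y k → y k ≤ 2 * R →
        |f k - Real.exp (-y k ^ 2 / 2)| ≤
          D * (1 + y k ^ 3) / R ^ 3 * Real.exp (-y k ^ 2 / 2)) →
      (∀ k ∈ s, 2 * R < y k → f k ≤ E * R ^ 3 * Real.exp (-c * R ^ 2)) →
      ∀ x, 0 ≤ x → x ≤ C * R →
        gaussTail x * (1 - C' * (1 + x ^ 3) / R ^ 3) ≤ κ / R ^ 3 * ∑ k ∈ s with x < y k, f k ∧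
        κ / R ^ 3 * ∑ k ∈ s with x ≤ y k, f k ≤ gaussTail x * (1 + C' * (1 + x ^ 3) / R ^ 3) := by
  obtain ⟨C, hC0, hC1, hC2⟩ : ∃ C : ℝ, 0 < C ∧ C ≤ 1 / 2 ∧ C ^ 2 ≤ c := by
    refine ⟨min (1 / 2) (√c), lt_min (by norm_num) (Real.sqrt_pos.2 hc), min_le_left _ _, ?_⟩
    calc (min (1 / 2) (√c)) ^ 2 ≤ (√c) ^ 2 := by gcongr; exact min_le_right _ _
      _ = c := Real.sq_sqrt hc.le
  refine ⟨C, hC0, 16 * (2 * κ + 5 * D) + 1, by positivity, ?_⟩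
  filter_upwards [eventually_ge_atTop 1, eventually_ge_atTop (3 * κ),
    eventually_mul_pow_le_exp_mul_sq (12 * κ * E) 10 (half_pos hc),
    eventually_mul_pow_le_exp_mul_sq 6 4 (a := 1 / 4) (by norm_num)] with R hR hκR' he1 he2
    s f y hcard hf0 hsep hcov hnear hfar x hx hxR
  have hR0 : 0 < R := by linarith
  have hR3 : 0 < R ^ 3 := by positivity
  have hκR : 3 * κ ≤ R ^ 2 := by nlinarith
  have hδ0 : 0 < κ / R ^ 3 := by positivity
  have hδR : κ / R ^ 3 ≤ R := by
    rw [div_le_iff₀ hR3]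
    nlinarith [pow_pos hR0 2]
  have hG := gaussTail_pos hx
  have hx3 : 0 ≤ x ^ 3 := by positivity
  have hxR2 : x ^ 2 ≤ C ^ 2 * R ^ 2 := by
    rw [← mul_pow]
    exact pow_le_pow_left₀ hx hxR 2
  have hxR1 : x ≤ R := hxR.trans (by nlinarith)
  have hGlow : Real.exp (-(C ^ 2 / 2 * R ^ 2)) ≤ 6 * R * gaussTail x := by
    calc Real.exp (-(C ^ 2 / 2 * R ^ 2)) ≤ Real.exp (-x ^ 2 / 2) :=
          Real.exp_le_exp.2 (by linarith)
      _ ≤ 3 * (1 + x) * gaussTail x := exp_le_gaussTail hx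
      _ ≤ _ := mul_le_mul_of_nonneg_right (by linarith) hG.le
  have hrem : ∀ u : ℝ, u * (6 * R ^ 4) ≤ Real.exp (-(C ^ 2 / 2 * R ^ 2)) →
      u ≤ gaussTail x / R ^ 3 := by
    intro u hu
    rw [le_div_iff₀ hR3]
    have : u * R ^ 3 * (6 * R) ≤ gaussTail x * (6 * R) := by
      calc u * R ^ 3 * (6 * R) = u * (6 * R ^ 4) := by ring
        _ ≤ _ := hu.trans hGlow
        _ = _ := by ring
    exact le_of_mul_le_mul_right this (by positivity)
  have hrem' : gaussTail x / R ^ 3 ≤ gaussTail x * ((1 + x ^ 3) / R ^ 3) := by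
    rw [div_eq_mul_one_div]
    gcongr
    linarith
  have hM := integral_one_add_cube_gauss_le hx
  have hintM := integrableOn_one_add_cube_gauss hx
  have hintF : ∀ b : ℝ, IntegrableOn (fun t : ℝ => Real.exp (-t ^ 2 / 2) +
      b * ((1 + t ^ 3) * Real.exp (-t ^ 2 / 2))) (Set.Ioi x) := fun b =>
    integrable_exp_neg_sq_half.integrableOn.add (hintM.const_mul b)
  have hF : ∀ b : ℝ, ∫ t in Set.Ioi x, (Real.exp (-t ^ 2 / 2) +
      b * ((1 + t ^ 3) * Real.exp (-t ^ 2 / 2))) = gaussTail x +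
      b * ∫ t in Set.Ioi x, (1 + t ^ 3) * Real.exp (-t ^ 2 / 2) := fun b => by
    rw [integral_add integrable_exp_neg_sq_half.integrableOn (hintM.const_mul b),
      integral_const_mul, gaussTail]
  constructor
  · set b := (2 * κ + 5 * D) / R ^ 3 with hb
    have hb0 : 0 < b := by positivity
    have h1 := setIntegral_le_mul_sum (s := s.filter fun k => x < y k) (f := f) (y := y)
      (F := fun t => Real.exp (-t ^ 2 / 2) + -b * ((1 + t ^ 3) * Real.exp (-t ^ 2 / 2)))
      (S := Set.Ioc x R) measurableSet_Ioc hδ0 (fun k hk => hf0 k (Finset.mem_filter.1 hk).1)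
      ((hintF (-b)).mono_set Set.Ioc_subset_Ioi_self) (fun t ht => by
        have ht0 : 0 ≤ t := hx.trans ht.1.le
        obtain ⟨k, hk, htk⟩ := hcov t ⟨lt_of_le_of_lt hx ht.1, ht.2⟩
        refine ⟨k, Finset.mem_filter.2 ⟨hk, lt_of_lt_of_le ht.1 htk.2⟩, htk, ?_⟩
        have := gauss_sub_exp_le hD hκ hR hκR ht0
          (hnear k hk (ht0.trans htk.2) (by linarith [htk.1, ht.2])) htk
        linarith)
    have h2 : ∫ t in Set.Ioi R, (Real.exp (-t ^ 2 / 2) +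
        -b * ((1 + t ^ 3) * Real.exp (-t ^ 2 / 2))) ≤ gaussTail R := by
      refine setIntegral_mono_on ((hintF (-b)).mono_set (Set.Ioi_subset_Ioi hxR1))
        integrable_exp_neg_sq_half.integrableOn measurableSet_Ioi fun t ht => ?_
      have ht0 : 0 ≤ t := hR0.le.trans (le_of_lt ht)
      have : 0 ≤ b * ((1 + t ^ 3) * Real.exp (-t ^ 2 / 2)) := by positivity
      linarith
    have h3 := setIntegral_union (Set.Ioc_disjoint_Ioi_same (a := x) (b := R)) measurableSet_Ioi
      ((hintF (-b)).mono_set Set.Ioc_subset_Ioi_self)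
      ((hintF (-b)).mono_set (Set.Ioi_subset_Ioi hxR1))
    rw [Set.Ioc_union_Ioi_eq_Ioi hxR1, hF] at h3
    have h4 : gaussTail R ≤ gaussTail x / R ^ 3 := by
      refine (gaussTail_le hR).trans (hrem _ ?_)
      have hsplit : Real.exp (-R ^ 2 / 2) =
          Real.exp (-(1 / 4 * R ^ 2)) * Real.exp (-(1 / 4 * R ^ 2)) := by
        rw [← Real.exp_add]
        ring_nf
      have he : Real.exp (-(1 / 4 * R ^ 2)) * (6 * R ^ 4) ≤ 1 := by
        rw [Real.exp_neg, inv_mul_le_one₀ (Real.exp_pos _)]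
        exact he2
      calc Real.exp (-R ^ 2 / 2) * (6 * R ^ 4)
          = Real.exp (-(1 / 4 * R ^ 2)) * (Real.exp (-(1 / 4 * R ^ 2)) * (6 * R ^ 4)) := by
            rw [hsplit]; ring
        _ ≤ Real.exp (-(1 / 4 * R ^ 2)) * 1 := by gcongr
        _ ≤ Real.exp (-(C ^ 2 / 2 * R ^ 2)) := by
            rw [mul_one]
            refine Real.exp_le_exp.2 ?_
            have : C ^ 2 ≤ 1 / 4 := by nlinarith
            nlinarith [sq_nonneg R]
    have h5 : b * ∫ t in Set.Ioi x, (1 + t ^ 3) * Real.exp (-t ^ 2 / 2) ≤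
        b * (16 * (1 + x ^ 3) * gaussTail x) := by gcongr
    calc gaussTail x * (1 - (16 * (2 * κ + 5 * D) + 1) * (1 + x ^ 3) / R ^ 3)
        = gaussTail x - b * (16 * (1 + x ^ 3) * gaussTail x) -
            gaussTail x * ((1 + x ^ 3) / R ^ 3) := by rw [hb]; ring
      _ ≤ _ := by linarith
  · set b := (2 * κ + 3 * D) / R ^ 3 with hb
    have hb0 : 0 < b := by positivity
    have h1 := mul_sum_le_setIntegral (s := {k ∈ {k ∈ s | x ≤ y k} | y k ≤ 2 * R})
      (f := f) (y := y) (x := x)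
      (F := fun t => Real.exp (-t ^ 2 / 2) + b * ((1 + t ^ 3) * Real.exp (-t ^ 2 / 2)))
      hδ0 (fun i hi j hj => hsep i (Finset.mem_filter.1 (Finset.mem_filter.1 hi).1).1 j
        (Finset.mem_filter.1 (Finset.mem_filter.1 hj).1).1)
      (fun t ht => by
        have ht0 : 0 ≤ t := hx.trans (le_of_lt ht)
        positivity) (hintF b) (fun k hk => (Finset.mem_filter.1 (Finset.mem_filter.1 hk).1).2)
      (fun k hk t ht => by
        obtain ⟨hk1, hk2⟩ := Finset.mem_filter.1 hk
        obtain ⟨hk3, hk4⟩ := Finset.mem_filter.1 hk1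
        exact exp_sub_gauss_le hD hκ hR hκR (hx.trans hk4) hk2
          (hnear k hk3 (hx.trans hk4) hk2) ht)
    rw [hF] at h1
    have h2 : κ / R ^ 3 * ∑ k ∈ {k ∈ {k ∈ s | x ≤ y k} | ¬ y k ≤ 2 * R}, f k ≤
        gaussTail x / R ^ 3 := by
      refine le_trans (b := κ / R ^ 3 * ((R ^ 6 + 1) * (E * R ^ 3 * Real.exp (-c * R ^ 2)))) ?_
        (hrem _ ?_)
      · gcongr
        calc ∑ k ∈ {k ∈ {k ∈ s | x ≤ y k} | ¬ y k ≤ 2 * R}, f k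
            ≤ ({k ∈ {k ∈ s | x ≤ y k} | ¬ y k ≤ 2 * R} : Finset ℕ).card •
                (E * R ^ 3 * Real.exp (-c * R ^ 2)) := by
              refine Finset.sum_le_card_nsmul _ _ _ fun k hk => ?_
              obtain ⟨hk1, hk2⟩ := Finset.mem_filter.1 hk
              exact hfar k (Finset.mem_filter.1 hk1).1 (not_le.1 hk2)
          _ ≤ _ := by
              rw [nsmul_eq_mul]
              gcongr
              refine le_trans ?_ hcard
              exact_mod_cast Finset.card_le_card
                ((Finset.filter_subset _ _).trans (Finset.filter_subset _ _))
      · have hsplit : Real.exp (-c * R ^ 2) =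
            Real.exp (-(c / 2 * R ^ 2)) * Real.exp (-(c / 2 * R ^ 2)) := by
          rw [← Real.exp_add]
          ring_nf
        have he : Real.exp (-(c / 2 * R ^ 2)) * (12 * κ * E * R ^ 10) ≤ 1 := by
          rw [Real.exp_neg, inv_mul_le_one₀ (Real.exp_pos _)]
          exact he1
        have hR6 : R ^ 6 + 1 ≤ 2 * R ^ 6 := by
          have := one_le_pow₀ hR (n := 6)
          linarith
        calc κ / R ^ 3 * ((R ^ 6 + 1) * (E * R ^ 3 * Real.exp (-c * R ^ 2))) * (6 * R ^ 4)
            ≤ κ / R ^ 3 * ((2 * R ^ 6) * (E * R ^ 3 * Real.exp (-c * R ^ 2))) * (6 * R ^ 4) := by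
              gcongr
          _ = Real.exp (-(c / 2 * R ^ 2)) *
                (Real.exp (-(c / 2 * R ^ 2)) * (12 * κ * E * R ^ 10)) := by
              rw [hsplit]
              field_simp
              ring
          _ ≤ Real.exp (-(c / 2 * R ^ 2)) * 1 := by gcongr
          _ ≤ Real.exp (-(C ^ 2 / 2 * R ^ 2)) := by
              rw [mul_one]
              refine Real.exp_le_exp.2 ?_
              nlinarith [sq_nonneg R]
    have h3 := Finset.sum_filter_add_sum_filter_not {k ∈ s | x ≤ y k} (fun k => y k ≤ 2 * R) f
    have h5 : b * ∫ t in Set.Ioi x, (1 + t ^ 3) * Real.exp (-t ^ 2 / 2) ≤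
        b * (16 * (1 + x ^ 3) * gaussTail x) := by gcongr
    have h6 : b * (16 * (1 + x ^ 3) * gaussTail x) ≤
        (2 * κ + 5 * D) / R ^ 3 * (16 * (1 + x ^ 3) * gaussTail x) := by
      rw [hb]
      gcongr
      norm_num
    calc κ / R ^ 3 * ∑ k ∈ s with x ≤ y k, f k
        ≤ gaussTail x + (2 * κ + 5 * D) / R ^ 3 * (16 * (1 + x ^ 3) * gaussTail x) +
            gaussTail x * ((1 + x ^ 3) / R ^ 3) := by
          rw [← h3, mul_add]
          linarith
      _ = _ := by ring

/-! ### Binomial coefficients -/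

lemma log_stirlingSeq_mem_Icc {n : ℕ} (hn : n ≠ 0) :
    Real.log (Stirling.stirlingSeq n) ∈
      Set.Icc (Real.log π / 2) (Real.log π / 2 + 1 / (12 * n)) := by
  have hlogπ : Real.log (√π) = Real.log π / 2 := Real.log_sqrt pi_pos.le
  constructor
  · rw [← hlogπ]
    exact Real.log_le_log (by positivity) (Stirling.sqrt_pi_le_stirlingSeq hn)
  · have hmono : Monotone fun j : ℕ =>
        Real.log (Stirling.stirlingSeq (j + 1)) - 1 / (12 * ((j : ℝ) + 1)) := by
      refine monotone_nat_of_le_succ fun j => ?_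
      have h := Stirling.log_stirlingSeq_sdiff_le (j + 1)
      have h2 : 1 / (12 * ((j : ℝ) + 1)) - 1 / (12 * ((j : ℝ) + 1 + 1)) =
          1 / (12 * ((j : ℝ) + 1) * ((j : ℝ) + 1 + 1)) := by
        field_simp
        ring
      push_cast at h ⊢
      linarith
    have hlim : Tendsto (fun j : ℕ =>
        Real.log (Stirling.stirlingSeq (j + 1)) - 1 / (12 * ((j : ℝ) + 1))) atTop
        (𝓝 (Real.log π / 2 - 0)) := by
      refine Tendsto.sub ?_ ?_
      · rw [← hlogπ]
        exact ((Real.continuousAt_log (by positivity)).tendsto.comp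
          Stirling.tendsto_stirlingSeq_sqrt_pi).comp (tendsto_add_atTop_nat 1)
      · have := (tendsto_one_div_add_atTop_nhds_zero_nat (𝕜 := ℝ)).const_mul (1 / 12)
        rw [mul_zero] at this
        refine this.congr fun j => ?_
        field_simp
    obtain ⟨j, rfl⟩ := Nat.exists_eq_succ_of_ne_zero hn
    have := hmono.ge_of_tendsto hlim j
    push_cast
    linarith

lemma log_factorial_eq {n : ℕ} (hn : n ≠ 0) :
    Real.log (n.factorial : ℝ) = Real.log (Stirling.stirlingSeq n) + Real.log 2 / 2 +
      Real.log n / 2 + n * Real.log n - n := by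
  have h := Stirling.log_stirlingSeq_formula n
  have hn' : (n : ℝ) ≠ 0 := by exact_mod_cast hn
  rw [Real.log_mul two_ne_zero hn', Real.log_div hn' (Real.exp_pos 1).ne', Real.log_exp] at h
  rw [h]
  ring

/-- Stirling's approximation of binomial coefficients in terms of the entropy function. -/
lemma abs_log_choose_sub_le {N k : ℕ} (hk : 0 < k) (hkN : k < N) {s : ℝ}
    (hs : s = (2 * k - N) / N) :
    |Real.log (N.choose k) - (N * Real.log 2 - N * binEnt s - Real.log (π * N / 2) / 2 -
      Real.log (1 - s ^ 2) / 2)| ≤ 1 / (12 * N) + 1 / (12 * k) + 1 / (12 * (N - k : ℝ)) := by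
  obtain ⟨l, rfl⟩ := Nat.exists_eq_add_of_lt hkN
  set l' := l + 1 with hl'
  have hl : 0 < l' := Nat.succ_pos l
  rw [show k + l + 1 = k + l' by omega] at *
  have hchoose : ((k + l').choose k : ℝ) =
      ((k + l').factorial : ℝ) / (k.factorial * l'.factorial) :=
    Nat.cast_add_choose ℝ
  have hk0 : (0 : ℝ) < k := by exact_mod_cast hk
  have hl0 : (0 : ℝ) < l' := by exact_mod_cast hl
  have hN0 : (0 : ℝ) < k + l' := by positivity
  push_cast at hs
  have h1s : 1 + s = 2 * k / (k + l') := by rw [hs]; field_simp; ring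
  have h2s : 1 - s = 2 * l' / (k + l') := by rw [hs]; field_simp; ring
  have hlog1 : Real.log (1 + s) = Real.log 2 + Real.log k - Real.log (k + l') := by
    rw [h1s, Real.log_div (by positivity) hN0.ne', Real.log_mul two_ne_zero hk0.ne']
  have hlog2 : Real.log (1 - s) = Real.log 2 + Real.log l' - Real.log (k + l') := by
    rw [h2s, Real.log_div (by positivity) hN0.ne', Real.log_mul two_ne_zero hl0.ne']
  have hlog3 : Real.log (1 - s ^ 2) = Real.log (1 + s) + Real.log (1 - s) := by
    rw [← Real.log_mul (by rw [h1s]; positivity) (by rw [h2s]; positivity)]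
    ring_nf
  have hent : (k + l' : ℝ) * binEnt s = k * Real.log (1 + s) + l' * Real.log (1 - s) := by
    rw [binEnt, hlog1, hlog2, h1s, h2s]
    field_simp
  have hpi : Real.log (π * (k + l') / 2) = Real.log π + Real.log (k + l') - Real.log 2 := by
    rw [Real.log_div (by positivity) two_ne_zero, Real.log_mul pi_ne_zero hN0.ne']
  have hf1 := log_factorial_eq hk.ne'
  have hf2 := log_factorial_eq hl.ne'
  have hf3 := log_factorial_eq (n := k + l') (by omega)
  have hs1 := log_stirlingSeq_mem_Icc hk.ne'
  have hs2 := log_stirlingSeq_mem_Icc hl.ne'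
  have hs3 := log_stirlingSeq_mem_Icc (n := k + l') (by omega)
  push_cast at hf3 hs3 ⊢
  rw [hchoose, Real.log_div (by positivity) (by positivity), Real.log_mul (by positivity)
    (by positivity), hf1, hf2, hf3, hent, hlog3, hpi, hlog1, hlog2]
  obtain ⟨a1, b1⟩ := hs1
  obtain ⟨a2, b2⟩ := hs2
  obtain ⟨a3, b3⟩ := hs3
  have p1 : 0 ≤ 1 / (12 * (k : ℝ)) := by positivity
  have p2 : 0 ≤ 1 / (12 * (l' : ℝ)) := by positivity
  have p3 : 0 ≤ 1 / (12 * ((k : ℝ) + l')) := by positivity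
  rw [add_sub_cancel_left]
  rw [abs_le]
  constructor <;> nlinarith

lemma choose_le_exp_binEnt {N k : ℕ} (hN : 0 < N) (hkN : k ≤ N) {s : ℝ}
    (hs : s = (2 * k - N) / N) :
    (N.choose k : ℝ) ≤ Real.exp (N * Real.log 2 - N * binEnt s) := by
  have hN0 : (0 : ℝ) < N := by exact_mod_cast hN
  rcases Nat.eq_zero_or_pos k with rfl | hk
  · have hs' : s = -1 := by rw [hs]; field_simp; simp
    have : binEnt s = Real.log 2 := by
      rw [hs', binEnt]
      norm_num
      ring
    simp [this]
  rcases hkN.eq_or_lt with rfl | hlt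
  · have hs' : s = 1 := by rw [hs]; field_simp; ring
    have : binEnt s = Real.log 2 := by
      rw [hs', binEnt]
      norm_num
      ring
    simp [this]
  obtain ⟨l, rfl⟩ := Nat.exists_eq_add_of_lt hlt
  set l' := l + 1 with hl'
  have hl : 0 < l' := Nat.succ_pos l
  rw [show k + l + 1 = k + l' by omega] at *
  have hk0 : (0 : ℝ) < k := by exact_mod_cast hk
  have hl0 : (0 : ℝ) < l' := by exact_mod_cast hl
  push_cast at hs hN0 ⊢
  have h1s : 1 + s = 2 * k / (k + l') := by rw [hs]; field_simp; ring
  have h2s : 1 - s = 2 * l' / (k + l') := by rw [hs]; field_simp; ring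
  have hlog1 : Real.log (k / (k + l')) = Real.log (1 + s) - Real.log 2 := by
    rw [h1s, ← Real.log_div (by positivity) two_ne_zero]
    congr 1
    field_simp
  have hlog2 : Real.log (l' / (k + l')) = Real.log (1 - s) - Real.log 2 := by
    rw [h2s, ← Real.log_div (by positivity) two_ne_zero]
    congr 1
    field_simp
  have hent : (k + l' : ℝ) * binEnt s = k * Real.log (1 + s) + l' * Real.log (1 - s) := by
    rw [binEnt, h1s, h2s]
    field_simp
  have hexp : Real.exp ((k + l') * Real.log 2 - (k + l') * binEnt s) *
      ((k / (k + l') : ℝ) ^ k * (l' / (k + l') : ℝ) ^ l') = 1 := by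
    rw [← Real.exp_log (show (0 : ℝ) < k / (k + l') by positivity),
      ← Real.exp_log (show (0 : ℝ) < l' / (k + l') by positivity), ← Real.exp_nat_mul,
      ← Real.exp_nat_mul, ← Real.exp_add, ← Real.exp_add, hlog1, hlog2, hent, Real.exp_eq_one_iff]
    ring
  have hbin : (k / (k + l') : ℝ) ^ k * (l' / (k + l') : ℝ) ^ l' * (k + l').choose k ≤ 1 := by
    have h := add_pow (k / (k + l') : ℝ) (l' / (k + l')) (k + l')
    rw [← add_div, div_self hN0.ne', one_pow] at h
    rw [h]
    have := Finset.single_le_sum (f := fun j => (k / (k + l') : ℝ) ^ j *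
      (l' / (k + l') : ℝ) ^ (k + l' - j) * (k + l').choose j) (fun j _ => by positivity)
      (Finset.mem_range.2 (show k < k + l' + 1 by omega))
    simpa using this
  have hpos : 0 < (k / (k + l') : ℝ) ^ k * (l' / (k + l') : ℝ) ^ l' := by positivity
  nlinarith

/-! ### The law of the magnetization -/

lemma cwHamiltonian_eq {p N : ℕ} (hN : 0 < N) (β h : ℝ) (x : Fin N → Bool) :
    cwHamiltonian p N β h x = N * (β * (mag x / N) ^ p + h * (mag x / N)) := by
  have hN0 : (N : ℝ) ≠ 0 := by exact_mod_cast hN.ne'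
  have hsum : ∑ i : Fin p → Fin N, ∏ j, spin (x (i j)) = mag x ^ p := by
    rw [mag, Fintype.sum_pow]
  rw [cwHamiltonian, hsum, zpow_sub₀ hN0, zpow_one, zpow_natCast, div_pow]
  field_simp

lemma mag_eq {N : ℕ} (x : Fin N → Bool) :
    mag x = 2 * ((Finset.univ.filter fun i => x i = true).card : ℝ) - N := by
  have h : ∀ b : Bool, spin b = 2 * (if b = true then 1 else 0) - 1 := by
    intro b
    cases b <;> norm_num [spin]
  simp only [mag, h, Finset.sum_sub_distrib, ← Finset.mul_sum, Finset.sum_boole]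
  simp

lemma sum_mag {N : ℕ} (g : ℝ → ℝ) :
    ∑ x : Fin N → Bool, g (mag x) =
      ∑ k ∈ Finset.range (N + 1), (N.choose k : ℝ) * g (2 * k - N) := by
  have h := Finset.sum_powerset_apply_card (fun k : ℕ => g (2 * k - N))
    (x := (Finset.univ : Finset (Fin N)))
  simp only [Finset.card_univ, Fintype.card_fin, nsmul_eq_mul] at h
  rw [← h, Finset.powerset_univ]
  refine Fintype.sum_bijective (fun x : Fin N → Bool => Finset.univ.filter fun i => x i = true)
    ?_ _ _ fun x => by rw [mag_eq]
  refine Function.bijective_iff_has_inverse.2 ⟨fun S i => decide (i ∈ S), fun x => ?_, fun S => ?_⟩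
  · ext i
    simp
  · ext i
    simp

/-- The total Gibbs weight of the configurations with `k` positive spins. -/
def levelWeight (p N : ℕ) (β h : ℝ) (k : ℕ) : ℝ :=
  (N.choose k : ℝ) *
    Real.exp (N * (β * ((2 * k - N : ℝ) / N) ^ p + h * ((2 * k - N : ℝ) / N)))

open Classical in
lemma sum_indicator_cwWeight {p N : ℕ} (hN : 0 < N) (β h : ℝ) (P : ℝ → Prop) :
    ∑ x : Fin N → Bool, Set.indicator {σ | P (mag σ)} (cwWeight p N β h) x =
      ∑ k ∈ (Finset.range (N + 1)).filter (fun k : ℕ => P (2 * k - N)), levelWeight p N β h k := by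
  have h1 := sum_mag (N := N) fun t => if P t then
    Real.exp (N * (β * (t / N) ^ p + h * (t / N))) else 0
  rw [Finset.sum_filter]
  convert! h1 using 2 with x _ k _
  · rw [Set.indicator_apply, cwWeight, cwHamiltonian_eq hN]
    rfl
  · rw [levelWeight]
    split_ifs <;> simp

open Classical in
lemma cwCondProb_eq {p N : ℕ} (hN : 0 < N) (β h : ℝ) (P Q : ℝ → Prop) :
    cwCondProb p N β h {σ | P (mag σ)} {σ | Q (mag σ)} =
      (∑ k ∈ (Finset.range (N + 1)).filter (fun k : ℕ => P (2 * k - N) ∧ Q (2 * k - N)),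
          levelWeight p N β h k) /
        ∑ k ∈ (Finset.range (N + 1)).filter (fun k : ℕ => Q (2 * k - N)),
          levelWeight p N β h k := by
  have hZ : 0 < ∑ x : Fin N → Bool, cwWeight p N β h x :=
    Finset.sum_pos (fun x _ => Real.exp_pos _) Finset.univ_nonempty
  have hset : ({σ | P (mag σ)} ∩ {σ | Q (mag σ)} : Set (Fin N → Bool)) =
    {σ | P (mag σ) ∧ Q (mag σ)} := rfl
  rw [cwCondProb, cwProb, cwProb, div_div_div_cancel_right₀ hZ.ne', hset,
    sum_indicator_cwWeight hN β h (fun t => P t ∧ Q t), sum_indicator_cwWeight hN β h Q]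
  congr!

/-! ### Local and global behaviour of `Hfun` -/

lemma abs_sub_le_of_hasDerivAt {g g' : ℝ → ℝ} {m s B : ℝ}
    (hg : ∀ t, |t - m| ≤ |s - m| → HasDerivAt g (g' t) t)
    (hB : ∀ t, |t - m| ≤ |s - m| → |g' t| ≤ B) : |g s - g m| ≤ B * |s - m| := by
  have hconv : Convex ℝ (Metric.closedBall m |s - m|) := convex_closedBall _ _
  refine hconv.norm_image_sub_le_of_norm_hasDerivWithin_le (f := g) (f' := g')
    (fun t ht => (hg t ?_).hasDerivWithinAt) (fun t ht => hB t ?_) ?_ ?_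
  · rwa [Metric.mem_closedBall, Real.dist_eq] at ht
  · rwa [Metric.mem_closedBall, Real.dist_eq] at ht
  · simp
  · rw [Metric.mem_closedBall, Real.dist_eq]

lemma exists_taylor_bound_of_deriv_eq_zero {f : ℝ → ℝ} {m : ℝ} (hf : ContDiffAt ℝ 3 f m)
    (hm : deriv f m = 0) :
    ∃ ε : ℝ, 0 < ε ∧ ∃ K : ℝ, 0 < K ∧ ∀ s, |s - m| ≤ ε →
      |f s - f m - iteratedDeriv 2 f m / 2 * (s - m) ^ 2| ≤ K * |s - m| ^ 3 := by
  have h1 : ContDiffAt ℝ 2 (deriv f) m := hf.derivWithin (by norm_num)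
  have h2 : ContDiffAt ℝ 1 (deriv (deriv f)) m := h1.derivWithin (by norm_num)
  rw [iteratedDeriv_succ, iteratedDeriv_one]
  obtain ⟨K, t, ht, hK⟩ := h2.exists_lipschitzOnWith
  have hd1 := (hf.eventually (by simp)).mono fun x hx => hx.differentiableAt (by simp)
  have hd2 := (h1.eventually (by simp)).mono fun x hx => hx.differentiableAt (by simp)
  obtain ⟨ε, hε, hball⟩ :=
    Metric.nhds_basis_closedBall.mem_iff.1 (inter_mem (inter_mem hd1 hd2) ht)
  refine ⟨ε, hε, K + 1, by positivity, fun s hs => ?_⟩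
  have hmem : ∀ x, |x - m| ≤ |s - m| →
      (DifferentiableAt ℝ f x ∧ DifferentiableAt ℝ (deriv f) x) ∧ x ∈ t := fun x hx =>
    hball (by rw [Metric.mem_closedBall, Real.dist_eq]; exact hx.trans hs)
  have hb2 : ∀ x, |x - m| ≤ |s - m| →
      |deriv (deriv f) x - deriv (deriv f) m| ≤ K * |x - m| := fun x hx =>
    hK.dist_le_mul x (hmem x hx).2 m (hmem m (by simp)).2
  have hb1 : ∀ x, |x - m| ≤ |s - m| →
      |deriv f x - deriv (deriv f) m * (x - m)| ≤ K * |x - m| ^ 2 := by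
    intro x hx
    have h := abs_sub_le_of_hasDerivAt (g := fun x => deriv f x - deriv (deriv f) m * (x - m))
      (g' := fun x => deriv (deriv f) x - deriv (deriv f) m) (m := m) (s := x) (B := K * |x - m|)
      (fun u hu => by
        convert! (hmem u (hu.trans hx)).1.2.hasDerivAt.sub
          (((hasDerivAt_id u).sub_const m).const_mul (deriv (deriv f) m)) using 1
        simp)
      (fun u hu => (hb2 u (hu.trans hx)).trans (by gcongr))
    simp only [sub_self, mul_zero, hm, sub_zero] at h
    calc _ ≤ K * |x - m| * |x - m| := h
      _ = _ := by ring
  have h := abs_sub_le_of_hasDerivAt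
    (g := fun x => f x - f m - deriv (deriv f) m / 2 * (x - m) ^ 2)
    (g' := fun x => deriv f x - deriv (deriv f) m * (x - m)) (m := m) (s := s)
    (B := K * |s - m| ^ 2)
    (fun u hu => by
      convert! ((hmem u hu).1.1.hasDerivAt.sub_const (f m)).sub
        ((((hasDerivAt_id u).sub_const m).pow 2).const_mul (deriv (deriv f) m / 2)) using 1
      simp only [id]
      push_cast
      ring)
    (fun u hu => (hb1 u hu).trans (by gcongr))
  simp only [sub_self, ne_eq, OfNat.ofNat_ne_zero, not_false_eq_true, zero_pow, mul_zero,
    sub_zero] at h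
  calc _ ≤ K * |s - m| ^ 2 * |s - m| := h
    _ = K * |s - m| ^ 3 := by ring
    _ ≤ (K + 1) * |s - m| ^ 3 := by gcongr; linarith

lemma continuous_Hfun (p : ℕ) (β h : ℝ) : Continuous (Hfun p β h) := by
  have h1 : Continuous fun x : ℝ => (1 + x) * Real.log (1 + x) :=
    Real.continuous_mul_log.comp (continuous_const.add continuous_id)
  have h2 : Continuous fun x : ℝ => (1 - x) * Real.log (1 - x) :=
    Real.continuous_mul_log.comp (continuous_const.sub continuous_id)
  unfold Hfun binEnt
  fun_prop

lemma contDiffAt_Hfun (p : ℕ) (β h : ℝ) {x : ℝ} (hx : x ∈ Set.Ioo (-1 : ℝ) 1) :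
    ContDiffAt ℝ 3 (Hfun p β h) x := by
  have h1 : 1 + x ≠ 0 := by linarith [hx.1]
  have h2 : 1 - x ≠ 0 := by linarith [hx.2]
  unfold Hfun binEnt
  fun_prop (disch := assumption)

lemma hasDerivAt_Hfun (p : ℕ) (β h : ℝ) {x : ℝ} (hx : x ∈ Set.Ioo (-1 : ℝ) 1) :
    HasDerivAt (Hfun p β h)
      (β * (p * x ^ (p - 1)) + h - (Real.log (1 + x) - Real.log (1 - x)) / 2) x := by
  have h1 : 1 + x ≠ 0 := by linarith [hx.1]
  have h2 : 1 - x ≠ 0 := by linarith [hx.2]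
  have d1 : HasDerivAt (fun x : ℝ => (1 + x) * Real.log (1 + x)) (Real.log (1 + x) + 1) x := by
    have := (Real.hasDerivAt_mul_log h1).comp x ((hasDerivAt_id x).const_add 1)
    convert! this using 1
    ring
  have d2 : HasDerivAt (fun x : ℝ => (1 - x) * Real.log (1 - x)) (-(Real.log (1 - x) + 1)) x := by
    have := (Real.hasDerivAt_mul_log h2).comp x ((hasDerivAt_id x).const_sub 1)
    convert! this using 1
    ring
  have := (((hasDerivAt_pow p x).const_mul β).add ((hasDerivAt_id x).const_mul h)).sub
    ((d1.add d2).const_mul (1 / 2))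
  convert! this using 1
  ring

lemma exists_Hfun_one_lt (p : ℕ) {β h : ℝ} (hβ : 0 < β) :
    ∃ x ∈ Set.Icc (-1 : ℝ) 1, Hfun p β h 1 < Hfun p β h x := by
  set e := Real.exp (-(2 * (β * p + |h|) + 1)) with he
  have he0 : 0 < e := Real.exp_pos _
  have he1 : e ≤ 1 := by
    have : 0 ≤ β * (p : ℝ) := by positivity
    exact Real.exp_le_one_iff.2 (by linarith [abs_nonneg h])
  refine ⟨1 - e, ⟨by linarith, by linarith⟩, ?_⟩
  refine strictAntiOn_of_deriv_neg (convex_Icc (1 - e) 1) (continuous_Hfun p β h).continuousOn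
    (fun x hx => ?_) ⟨le_refl _, by linarith⟩ ⟨by linarith, le_refl _⟩ (by linarith)
  rw [interior_Icc] at hx
  have hx0 : 0 ≤ x := by linarith [hx.1]
  rw [(hasDerivAt_Hfun p β h ⟨by linarith, hx.2⟩).deriv]
  have h1 : x ^ (p - 1) ≤ 1 := pow_le_one₀ hx0 hx.2.le
  have h2 : 0 ≤ Real.log (1 + x) := Real.log_nonneg (by linarith)
  have h3 : Real.log (1 - x) ≤ -(2 * (β * p + |h|) + 1) := by
    rw [Real.log_le_iff_le_exp (by linarith [hx.2])]
    linarith [hx.1]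
  have h4 : β * (p * x ^ (p - 1)) ≤ β * (p * 1) := by gcongr
  linarith [le_abs_self h]

lemma exists_Hfun_neg_one_lt (p : ℕ) {β h : ℝ} (hβ : 0 < β) :
    ∃ x ∈ Set.Icc (-1 : ℝ) 1, Hfun p β h (-1) < Hfun p β h x := by
  set e := Real.exp (-(2 * (β * p + |h|) + 1)) with he
  have he0 : 0 < e := Real.exp_pos _
  have he1 : e ≤ 1 := by
    have : 0 ≤ β * (p : ℝ) := by positivity
    exact Real.exp_le_one_iff.2 (by linarith [abs_nonneg h])
  refine ⟨-1 + e, ⟨by linarith, by linarith⟩, ?_⟩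
  refine strictMonoOn_of_deriv_pos (convex_Icc (-1) (-1 + e)) (continuous_Hfun p β h).continuousOn
    (fun x hx => ?_) ⟨le_refl _, by linarith⟩ ⟨by linarith, le_refl _⟩ (by linarith)
  rw [interior_Icc] at hx
  have hx0 : x ≤ 0 := by linarith [hx.2]
  rw [(hasDerivAt_Hfun p β h ⟨hx.1, by linarith⟩).deriv]
  have h1 : -1 ≤ x ^ (p - 1) := by
    have : |x ^ (p - 1)| ≤ 1 := by
      rw [abs_pow]
      exact pow_le_one₀ (abs_nonneg x) (abs_le.2 ⟨hx.1.le, by linarith⟩)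
    exact (abs_le.1 this).1
  have h2 : 0 ≤ Real.log (1 - x) := Real.log_nonneg (by linarith)
  have h3 : Real.log (1 + x) ≤ -(2 * (β * p + |h|) + 1) := by
    rw [Real.log_le_iff_le_exp (by linarith [hx.1])]
    linarith [hx.2]
  have h4 : β * (p * (-1)) ≤ β * (p * x ^ (p - 1)) := by gcongr
  linarith [neg_abs_le h]

lemma exists_Hfun_taylor_bound {p : ℕ} {β h m : ℝ} (hmax : isMaximizer p β h m) :
    ∃ ε : ℝ, 0 < ε ∧ ∃ K : ℝ, 0 < K ∧ ∀ s, |s - m| ≤ ε →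
      |Hfun p β h s - Hfun p β h m - iteratedDeriv 2 (Hfun p β h) m / 2 * (s - m) ^ 2| ≤
        K * |s - m| ^ 3 := by
  refine exists_taylor_bound_of_deriv_eq_zero (contDiffAt_Hfun p β h hmax.1) ?_
  refine IsLocalMax.deriv_eq_zero ?_
  filter_upwards [isOpen_Ioo.mem_nhds hmax.1] with x hx
  exact hmax.2 x ⟨hx.1.le, hx.2.le⟩

lemma exists_log_one_sub_sq_bound {m : ℝ} (hm : m ∈ Set.Ioo (-1 : ℝ) 1) :
    ∃ ε : ℝ, 0 < ε ∧ ∃ K : ℝ, 0 < K ∧ ∀ s, |s - m| ≤ ε →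
      |Real.log (1 - s ^ 2) - Real.log (1 - m ^ 2)| ≤ K * |s - m| := by
  have hne : 1 - m ^ 2 ≠ 0 := by nlinarith [hm.1, hm.2]
  have hc : ContDiffAt ℝ 1 (fun s : ℝ => Real.log (1 - s ^ 2)) m := by
    fun_prop (disch := assumption)
  obtain ⟨K, t, ht, hK⟩ := hc.exists_lipschitzOnWith
  obtain ⟨ε, hε, hball⟩ := Metric.nhds_basis_closedBall.mem_iff.1 ht
  refine ⟨ε, hε, K + 1, by positivity, fun s hs => ?_⟩
  have := hK.dist_le_mul s (hball (by rwa [Metric.mem_closedBall, Real.dist_eq])) m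
    (hball (Metric.mem_closedBall_self hε.le))
  rw [Real.dist_eq, Real.dist_eq] at this
  nlinarith [abs_nonneg (s - m)]

/-- Away from the other maximizers, `Hfun` lies below a parabola touching it at `m`. -/
lemma exists_Hfun_le_sub_sq {p : ℕ} {β h m : ℝ} (hβ : 0 < β) (hmax : isMaximizer p β h m)
    (hH : iteratedDeriv 2 (Hfun p β h) m < 0) {A : Set ℝ}
    (hA : ∀ x ∈ closure A, isMaximizer p β h x → x = m) :
    ∃ c : ℝ, 0 < c ∧ ∀ s ∈ A, s ∈ Set.Icc (-1 : ℝ) 1 →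
      Hfun p β h s ≤ Hfun p β h m - c * (s - m) ^ 2 := by
  obtain ⟨ε, hε, K, hK, hT⟩ := exists_Hfun_taylor_bound hmax
  set v := -iteratedDeriv 2 (Hfun p β h) m with hv
  have hv0 : 0 < v := by linarith
  set r := min ε (v / (4 * K)) with hr
  have hr0 : 0 < r := lt_min hε (by positivity)
  have hnear : ∀ s, |s - m| ≤ r → Hfun p β h s ≤ Hfun p β h m - v / 4 * (s - m) ^ 2 := by
    intro s hs
    have h1 := (abs_le.1 (hT s (hs.trans (min_le_left _ _)))).2
    have h2 : K * |s - m| ≤ v / 4 := by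
      calc K * |s - m| ≤ K * (v / (4 * K)) := by gcongr; exact hs.trans (min_le_right _ _)
        _ = v / 4 := by field_simp
    have h3 : K * |s - m| ^ 3 ≤ v / 4 * (s - m) ^ 2 := by
      calc K * |s - m| ^ 3 = K * |s - m| * |s - m| ^ 2 := by ring
        _ ≤ v / 4 * |s - m| ^ 2 := by gcongr
        _ = _ := by rw [sq_abs]
    nlinarith
  set S := closure A ∩ Set.Icc (-1 : ℝ) 1 ∩ {s | r ≤ |s - m|} with hS
  have hScomp : IsCompact S := by
    rw [hS, Set.inter_assoc]
    refine IsCompact.inter_left ?_ isClosed_closure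
    exact isCompact_Icc.inter_right (isClosed_le continuous_const (by fun_prop))
  have hSlt : ∀ s ∈ S, Hfun p β h s < Hfun p β h m := by
    intro s hs
    obtain ⟨⟨hsA, hsI⟩, hsr⟩ := hs
    refine lt_of_le_of_ne (hmax.2 s hsI) fun heq => ?_
    have hne1 : s ≠ 1 := by
      rintro rfl
      obtain ⟨x, hx, hlt⟩ := exists_Hfun_one_lt p (h := h) hβ
      linarith [hmax.2 x hx]
    have hne2 : s ≠ -1 := by
      rintro rfl
      obtain ⟨x, hx, hlt⟩ := exists_Hfun_neg_one_lt p (h := h) hβ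
      linarith [hmax.2 x hx]
    have hsm : s = m := hA s hsA ⟨⟨lt_of_le_of_ne hsI.1 hne2.symm, lt_of_le_of_ne hsI.2 hne1⟩,
      fun x hx => heq ▸ hmax.2 x hx⟩
    have : r ≤ |s - m| := hsr
    rw [hsm, sub_self, abs_zero] at this
    linarith
  obtain ⟨η, hη, hfar⟩ : ∃ η : ℝ, 0 < η ∧ ∀ s ∈ S, Hfun p β h s ≤ Hfun p β h m - η := by
    rcases S.eq_empty_or_nonempty with hSe | hSne
    · exact ⟨1, one_pos, by simp [hSe]⟩
    · obtain ⟨s₀, hs₀, hmx⟩ := hScomp.exists_isMaxOn hSne (continuous_Hfun p β h).continuousOn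
      refine ⟨Hfun p β h m - Hfun p β h s₀, sub_pos.2 (hSlt s₀ hs₀), fun s hs => ?_⟩
      have : Hfun p β h s ≤ Hfun p β h s₀ := hmx hs
      linarith
  refine ⟨min (v / 4) (η / 4), lt_min (by positivity) (by positivity), fun s hsA hsI => ?_⟩
  have hsq := sq_nonneg (s - m)
  rcases le_total |s - m| r with hs | hs
  · have := mul_le_mul_of_nonneg_right (min_le_left (v / 4) (η / 4)) hsq
    linarith [hnear s hs]
  · have h1 := hfar s ⟨⟨subset_closure hsA, hsI⟩, hs⟩
    have h2 := mul_le_mul_of_nonneg_right (min_le_right (v / 4) (η / 4)) hsq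
    have h3 : (s - m) ^ 2 ≤ 2 ^ 2 := by
      refine sq_le_sq' ?_ ?_ <;> linarith [hsI.1, hsI.2, hmax.1.1, hmax.1.2]
    nlinarith

/-! ### Weights of the levels in the Gaussian scaling -/

/-- The logarithm of the peak of `levelWeight` at the maximizer `m`. -/
def logPeak (p N : ℕ) (β h m : ℝ) : ℝ :=
  N * Real.log 2 + N * Hfun p β h m - Real.log (π * N / 2) / 2 - Real.log (1 - m ^ 2) / 2

lemma abs_exp_sub_one_le_mul_exp (u : ℝ) : |Real.exp u - 1| ≤ |u| * Real.exp |u| := by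
  have h1 := Real.add_one_le_exp (-u)
  have h2 := Real.add_one_le_exp u
  have h3 : Real.exp (-u) * Real.exp u = 1 := by rw [← Real.exp_add]; simp
  have h4 : Real.exp u ≤ Real.exp |u| := Real.exp_le_exp.2 (le_abs_self u)
  have h5 : 1 ≤ Real.exp |u| := Real.one_le_exp (abs_nonneg u)
  rw [abs_le]
  constructor
  · nlinarith [neg_abs_le u, abs_nonneg u]
  · calc Real.exp u - 1 ≤ u * Real.exp u := by nlinarith [Real.exp_pos u]
      _ ≤ |u| * Real.exp |u| := by
        gcongr
        exact le_abs_self u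

lemma eventually_div_sq_le {a b : ℝ} (hb : 0 < b) : ∀ᶠ R : ℝ in atTop, a / R ^ 2 ≤ b := by
  have h : Tendsto (fun R : ℝ => a / R ^ 2) atTop (𝓝 0) :=
    tendsto_const_nhds.div_atTop (tendsto_pow_atTop two_ne_zero)
  exact (h.eventually (gt_mem_nhds hb)).mono fun R hR => le_of_lt hR

lemma exists_levelWeight_eq_gauss_mul_exp {p : ℕ} {β h m : ℝ} (hmax : isMaximizer p β h m)
    (hH : iteratedDeriv 2 (Hfun p β h) m < 0) :
    ∃ D : ℝ, 0 < D ∧ ∀ᶠ R : ℝ in atTop, ∀ N k : ℕ, (N : ℝ) = R ^ 6 → ∀ y : ℝ, |y| ≤ 2 * R →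
      2 * k - N - N * m = y * (R ^ 3 / √(-iteratedDeriv 2 (Hfun p β h) m)) →
      ∃ u : ℝ, |u| ≤ D * (1 + |y| ^ 3) / R ^ 3 ∧
        levelWeight p N β h k * Real.exp (-logPeak p N β h m) =
          Real.exp (-y ^ 2 / 2) * Real.exp u := by
  obtain ⟨ε₁, hε₁, K₁, hK₁, hT₁⟩ := exists_Hfun_taylor_bound hmax
  obtain ⟨ε₂, hε₂, K₂, hK₂, hT₂⟩ := exists_log_one_sub_sq_bound hmax.1
  obtain ⟨H₂, hH₂⟩ : ∃ H₂, H₂ = iteratedDeriv 2 (Hfun p β h) m := ⟨_, rfl⟩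
  rw [← hH₂] at hT₁ hH ⊢
  obtain ⟨w, hw⟩ : ∃ w, w = √(-H₂) := ⟨_, rfl⟩
  have hw0 : 0 < w := hw ▸ Real.sqrt_pos.2 (by linarith)
  have hw2 : w ^ 2 = -H₂ := by rw [hw, Real.sq_sqrt (by linarith)]
  rw [← hw]
  obtain ⟨q, hq0, hq1, hq2⟩ : ∃ q : ℝ, 0 < q ∧ 2 * q ≤ 1 + m ∧ 2 * q ≤ 1 - m := by
    have h1 := hmax.1.1
    have h2 := hmax.1.2
    refine ⟨min ((1 + m) / 2) ((1 - m) / 2), lt_min (by linarith) (by linarith), ?_, ?_⟩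
    · linarith [min_le_left ((1 + m) / 2) ((1 - m) / 2)]
    · linarith [min_le_right ((1 + m) / 2) ((1 - m) / 2)]
  obtain ⟨D, hD⟩ : ∃ D, D = 1 / 12 + 1 / (3 * q) + K₁ / w ^ 3 + K₂ / (2 * w) := ⟨_, rfl⟩
  have hD0 : 0 < D := by rw [hD]; positivity
  refine ⟨D, hD0, ?_⟩
  filter_upwards [eventually_ge_atTop 1, eventually_div_sq_le (a := 2 / w) hε₁,
    eventually_div_sq_le (a := 2 / w) hε₂, eventually_div_sq_le (a := 2 / w) hq0]
    with R hR he₁ he₂ heq N k hN y hy hky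
  have hR0 : 0 < R := by linarith
  have hN0 : (0 : ℝ) < N := by rw [hN]; positivity
  obtain ⟨s, hs⟩ : ∃ s : ℝ, s = (2 * k - N) / N := ⟨_, rfl⟩
  have hsm : s - m = y / (w * R ^ 3) := by
    have : s - m = (2 * k - N - N * m) / N := by rw [hs]; field_simp
    rw [this, hky, hN]
    field_simp
  have habs : |s - m| = |y| / (w * R ^ 3) := by
    rw [hsm, abs_div, abs_of_pos (show 0 < w * R ^ 3 by positivity)]
  have hsm' : |s - m| ≤ 2 / w / R ^ 2 := by
    rw [habs]
    calc |y| / (w * R ^ 3) ≤ 2 * R / (w * R ^ 3) := by gcongr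
      _ = _ := by field_simp
  have hsq := abs_le.1 (hsm'.trans heq)
  have hk : (k : ℝ) = N * (1 + s) / 2 := by rw [hs]; field_simp; ring
  have hNk : (N - k : ℝ) = N * (1 - s) / 2 := by rw [hk]; ring
  have hkq : N * q / 2 ≤ (k : ℝ) := by
    rw [hk]
    gcongr
    linarith
  have hNkq : N * q / 2 ≤ (N - k : ℝ) := by
    rw [hNk]
    gcongr
    linarith
  have hNq : 0 < N * q / 2 := by positivity
  have hk0 : 0 < k := by exact_mod_cast hNq.trans_le hkq
  have hkN : k < N := by
    have : (k : ℝ) < N := by linarith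
    exact_mod_cast this
  have hst := abs_log_choose_sub_le hk0 hkN hs
  have h1 := hT₁ s (hsm'.trans he₁)
  have h2 := hT₂ s (hsm'.trans he₂)
  have hy3 : |y| ≤ 1 + |y| ^ 3 := by
    nlinarith [abs_nonneg y, sq_nonneg (|y| - 1), mul_nonneg (abs_nonneg y) (sq_nonneg (|y| - 1))]
  have b1 : 1 / (12 * N) + 1 / (12 * k) + 1 / (12 * (N - k : ℝ)) ≤
      (1 / 12 + 1 / (3 * q)) * (1 + |y| ^ 3) / R ^ 3 := by
    calc 1 / (12 * N) + 1 / (12 * k) + 1 / (12 * (N - k : ℝ))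
        ≤ 1 / (12 * N) + 1 / (12 * (N * q / 2)) + 1 / (12 * (N * q / 2)) := by gcongr
      _ = (1 / 12 + 1 / (3 * q)) * 1 / N := by field_simp; ring
      _ ≤ (1 / 12 + 1 / (3 * q)) * (1 + |y| ^ 3) / R ^ 3 := by
          rw [hN]
          gcongr
          · linarith [pow_nonneg (abs_nonneg y) 3]
          · norm_num
  have b2 : N * (K₁ * |s - m| ^ 3) ≤ K₁ / w ^ 3 * (1 + |y| ^ 3) / R ^ 3 := by
    calc N * (K₁ * |s - m| ^ 3) = K₁ / w ^ 3 * |y| ^ 3 / R ^ 3 := by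
          rw [habs, hN]
          field_simp
      _ ≤ _ := by gcongr; linarith
  have b3 : K₂ * |s - m| / 2 ≤ K₂ / (2 * w) * (1 + |y| ^ 3) / R ^ 3 := by
    calc K₂ * |s - m| / 2 = K₂ / (2 * w) * |y| / R ^ 3 := by
          rw [habs]
          field_simp
      _ ≤ _ := by gcongr
  have hquad : N * (H₂ / 2 * (s - m) ^ 2) = -y ^ 2 / 2 := by
    have : H₂ = -w ^ 2 := by linarith
    rw [hsm, hN, this]
    field_simp
  obtain ⟨u, hu⟩ : ∃ u, u = Real.log (N.choose k) + N * (β * s ^ p + h * s) -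
    logPeak p N β h m + y ^ 2 / 2 := ⟨_, rfl⟩
  have hchoose : (0 : ℝ) < N.choose k := by exact_mod_cast Nat.choose_pos hkN.le
  have hlw : levelWeight p N β h k * Real.exp (-logPeak p N β h m) =
      Real.exp (-y ^ 2 / 2) * Real.exp u := by
    rw [levelWeight, ← hs, ← Real.exp_log hchoose, ← Real.exp_add, ← Real.exp_add, ← Real.exp_add,
      hu]
    congr 1
    ring
  have hub : |u| ≤ D * (1 + |y| ^ 3) / R ^ 3 := by
    have hu' : u = (Real.log (N.choose k) - (N * Real.log 2 - N * binEnt s -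
        Real.log (π * N / 2) / 2 - Real.log (1 - s ^ 2) / 2)) +
        N * (Hfun p β h s - Hfun p β h m - H₂ / 2 * (s - m) ^ 2) -
        (Real.log (1 - s ^ 2) - Real.log (1 - m ^ 2)) / 2 := by
      rw [hu, logPeak]
      simp only [mul_sub, hquad]
      rw [show N * Hfun p β h s = N * (β * s ^ p + h * s) - N * binEnt s by rw [Hfun]; ring]
      ring
    have h1' : |N * (Hfun p β h s - Hfun p β h m - H₂ / 2 * (s - m) ^ 2)| ≤
        N * (K₁ * |s - m| ^ 3) := by
      rw [abs_mul, abs_of_pos hN0]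
      gcongr
    have hDsplit : D * (1 + |y| ^ 3) / R ^ 3 = (1 / 12 + 1 / (3 * q)) * (1 + |y| ^ 3) / R ^ 3 +
        K₁ / w ^ 3 * (1 + |y| ^ 3) / R ^ 3 + K₂ / (2 * w) * (1 + |y| ^ 3) / R ^ 3 := by
      rw [hD]
      ring
    rw [hu', hDsplit]
    rw [abs_le] at hst h1' h2 ⊢
    constructor <;> linarith [hst.1, hst.2, h1'.1, h1'.2, h2.1, h2.2]
  exact ⟨u, hub, hlw⟩

lemma abs_levelWeight_sub_gauss_le {p : ℕ} {β h m : ℝ} (hmax : isMaximizer p β h m)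
    (hH : iteratedDeriv 2 (Hfun p β h) m < 0) :
    ∃ D : ℝ, 0 < D ∧ ∀ᶠ R : ℝ in atTop, ∀ N k : ℕ, (N : ℝ) = R ^ 6 → ∀ y : ℝ, |y| ≤ 2 * R →
      2 * k - N - N * m = y * (R ^ 3 / √(-iteratedDeriv 2 (Hfun p β h) m)) →
      |levelWeight p N β h k * Real.exp (-logPeak p N β h m) - Real.exp (-y ^ 2 / 2)| ≤
        D * (1 + |y| ^ 3) / R ^ 3 * Real.exp (-y ^ 2 / 2) := by
  obtain ⟨D, hD0, hD⟩ := exists_levelWeight_eq_gauss_mul_exp hmax hH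
  refine ⟨D * Real.exp (9 * D), by positivity, ?_⟩
  filter_upwards [eventually_ge_atTop 1, hD] with R hR hDR N k hN y hy hky
  obtain ⟨u, hub, hlw⟩ := hDR N k hN y hy hky
  have hR0 : 0 < R := by linarith
  have hub' : |u| ≤ 9 * D := by
    refine hub.trans ?_
    rw [div_le_iff₀ (by positivity)]
    have h8 : |y| ^ 3 ≤ (2 * R) ^ 3 := pow_le_pow_left₀ (abs_nonneg y) hy 3
    have h9 : 1 ≤ R ^ 3 := one_le_pow₀ hR
    nlinarith
  rw [hlw, ← mul_sub_one, abs_mul, abs_of_pos (Real.exp_pos (-y ^ 2 / 2)), mul_comm]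
  refine mul_le_mul_of_nonneg_right ?_ (Real.exp_pos _).le
  calc |Real.exp u - 1| ≤ |u| * Real.exp |u| := abs_exp_sub_one_le_mul_exp u
    _ ≤ D * (1 + |y| ^ 3) / R ^ 3 * Real.exp (9 * D) := by gcongr
    _ = _ := by ring

lemma exp_neg_logPeak_le {p N : ℕ} {β h m : ℝ} (hm : m ∈ Set.Ioo (-1 : ℝ) 1) {R : ℝ} (hR : 0 < R)
    (hN : (N : ℝ) = R ^ 6) :
    Real.exp (-logPeak p N β h m) ≤
      2 * R ^ 3 * Real.exp (-(N * Real.log 2 + N * Hfun p β h m)) := by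
  have hm2 : 0 < 1 - m ^ 2 := by nlinarith [hm.1, hm.2]
  have hN0 : (0 : ℝ) < N := by rw [hN]; positivity
  have h1 : Real.log (1 - m ^ 2) ≤ 0 := Real.log_nonpos hm2.le (by nlinarith [sq_nonneg m])
  have h2 : Real.log (π * N / 2) / 2 ≤ Real.log (2 * R ^ 3) := by
    have : Real.log (π * N / 2) ≤ Real.log ((2 * R ^ 3) ^ 2) := by
      refine Real.log_le_log (by positivity) ?_
      have : 0 < R ^ 6 := by positivity
      rw [hN]
      nlinarith [pi_le_four]
    rw [Real.log_pow] at this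
    push_cast at this
    linarith
  rw [← Real.exp_log (show 0 < 2 * R ^ 3 by positivity), ← Real.exp_add]
  refine Real.exp_le_exp.2 ?_
  rw [logPeak]
  linarith

lemma levelWeight_le_of_far {p N k : ℕ} {β h m c w R y : ℝ} {A : Set ℝ}
    (hm : m ∈ Set.Ioo (-1 : ℝ) 1) (hc : 0 < c) (hw : 0 < w) (hR : 0 < R)
    (hA : ∀ s ∈ A, s ∈ Set.Icc (-1 : ℝ) 1 → Hfun p β h s ≤ Hfun p β h m - c * (s - m) ^ 2)
    (hN : (N : ℝ) = R ^ 6) (hkN : k ≤ N) (hkA : (2 * k - N : ℝ) / N ∈ A) (hy : 2 * R ≤ |y|)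
    (hky : 2 * k - N - N * m = y * (R ^ 3 / w)) :
    levelWeight p N β h k * Real.exp (-logPeak p N β h m) ≤
      2 * R ^ 3 * Real.exp (-(4 * c / w ^ 2) * R ^ 2) := by
  have hN0 : (0 : ℝ) < N := by rw [hN]; positivity
  have hkN' : (k : ℝ) ≤ N := by exact_mod_cast hkN
  obtain ⟨s, hs⟩ : ∃ s : ℝ, s = (2 * k - N) / N := ⟨_, rfl⟩
  have hsm : s - m = y / (w * R ^ 3) := by
    have : s - m = (2 * k - N - N * m) / N := by rw [hs]; field_simp
    rw [this, hky, hN]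
    field_simp
  have hsI : s ∈ Set.Icc (-1 : ℝ) 1 := by
    rw [hs]
    constructor
    · rw [le_div_iff₀ hN0]
      linarith [(Nat.cast_nonneg k : (0 : ℝ) ≤ k)]
    · rw [div_le_iff₀ hN0]
      linarith
  have hchoose := choose_le_exp_binEnt (by exact_mod_cast hN0) hkN hs
  have hHs := hA s (hs ▸ hkA) hsI
  have hy2 : (2 * R) ^ 2 ≤ y ^ 2 := by
    rw [← sq_abs y]
    exact pow_le_pow_left₀ (by positivity) hy 2
  have hquad : 4 * c / w ^ 2 * R ^ 2 ≤ N * (c * (s - m) ^ 2) := by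
    calc 4 * c / w ^ 2 * R ^ 2 = c / w ^ 2 * (2 * R) ^ 2 := by ring
      _ ≤ c / w ^ 2 * y ^ 2 := by gcongr
      _ = _ := by
        rw [hsm, hN]
        field_simp
  calc levelWeight p N β h k * Real.exp (-logPeak p N β h m)
      ≤ (Real.exp (N * Real.log 2 - N * binEnt s) * Real.exp (N * (β * s ^ p + h * s))) *
        (2 * R ^ 3 * Real.exp (-(N * Real.log 2 + N * Hfun p β h m))) := by
        rw [levelWeight, ← hs]
        gcongr
        exact exp_neg_logPeak_le hm hR hN
    _ = 2 * R ^ 3 * Real.exp (N * (Hfun p β h s - Hfun p β h m)) := by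
        rw [← Real.exp_add, mul_left_comm, ← Real.exp_add, Hfun, Hfun]
        congr 2
        ring
    _ ≤ _ := by
        refine mul_le_mul_of_nonneg_left (Real.exp_le_exp.2 ?_) (by positivity)
        have := mul_le_mul_of_nonneg_left hHs hN0.le
        linarith

/-! ### Riemann sums over the magnetization levels -/

lemma exists_int_mul_sub_div_mem {τ a σ : ℝ} (hτ : τ = 1 ∨ τ = -1) (hσ : 0 < σ) (t : ℝ) :
    ∃ k : ℤ, t ≤ τ * ((2 * k - a) / σ) ∧ τ * ((2 * k - a) / σ) < t + 2 / σ := by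
  rcases hτ with rfl | rfl
  · have h1 := Int.le_ceil ((t * σ + a) / 2)
    have h2 := Int.ceil_lt_add_one ((t * σ + a) / 2)
    refine ⟨⌈(t * σ + a) / 2⌉, ?_, ?_⟩
    · rw [one_mul, le_div_iff₀ hσ]
      linarith
    · rw [one_mul, div_lt_iff₀ hσ, add_mul, div_mul_cancel₀ _ hσ.ne']
      linarith
  · have h1 := Int.le_ceil ((t * σ - a) / 2)
    have h2 := Int.ceil_lt_add_one ((t * σ - a) / 2)
    have h3 (z : ℝ) : -1 * ((2 * -z - a) / σ) = (2 * z + a) / σ := by ring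
    refine ⟨-⌈(t * σ - a) / 2⌉, ?_, ?_⟩ <;> push_cast <;> rw [h3]
    · rw [le_div_iff₀ hσ]
      linarith
    · rw [div_lt_iff₀ hσ, add_mul, div_mul_cancel₀ _ hσ.ne']
      linarith

/-- The levels `(2k - N)/N` inside a neighbourhood of `m`, rescaled by `±w N^{1/2}`, cover
`(0, R]` with mesh `2w/R³` when `N = R⁶`. -/
lemma exists_level_covering {m ε w R τ t : ℝ} {A : Set ℝ} {N : ℕ}
    (hA : Metric.ball m ε ⊆ A ∩ Set.Ioo (-1) 1) (hw : 0 < w) (hR : 1 ≤ R) (hwR : 2 * w ≤ R)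
    (hεR : 2 / w / R ^ 2 < ε) (hN : (N : ℝ) = R ^ 6) (hτ : τ = 1 ∨ τ = -1)
    (ht : t ∈ Set.Ioc 0 R) :
    ∃ k : ℕ, k < N + 1 ∧ (2 * k - N : ℝ) / N ∈ A ∧
      t ∈ Set.Ioc (τ * ((2 * k - N - N * m) / (R ^ 3 / w)) - 2 * w / R ^ 3)
        (τ * ((2 * k - N - N * m) / (R ^ 3 / w))) := by
  have hR0 : 0 < R := by linarith
  have hN0 : (0 : ℝ) < N := by rw [hN]; positivity
  have hσ : 0 < R ^ 3 / w := by positivity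
  obtain ⟨k, hk1, hk2⟩ := exists_int_mul_sub_div_mem (a := N + N * m) hτ hσ t
  have hδ : 2 / (R ^ 3 / w) = 2 * w / R ^ 3 := by field_simp
  rw [hδ] at hk2
  have hδR : 2 * w / R ^ 3 ≤ R := by
    rw [div_le_iff₀ (by positivity)]
    calc 2 * w ≤ R * 1 := by linarith
      _ ≤ R * R ^ 3 := by gcongr; exact one_le_pow₀ hR
  have habs : |(2 * k - (N + N * m)) / (R ^ 3 / w)| ≤ 2 * R := by
    rw [abs_le]
    have := ht.1
    have := ht.2
    rcases hτ with rfl | rfl <;> constructor <;> linarith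
  have hsm : |(2 * k - N : ℝ) / N - m| ≤ 2 / w / R ^ 2 := by
    have h1 : (2 * k - N : ℝ) / N - m = (2 * k - (N + N * m)) / (R ^ 3 / w) / (w * R ^ 3) := by
      rw [hN]
      field_simp
      ring
    rw [h1, abs_div, abs_of_pos (show 0 < w * R ^ 3 by positivity), div_le_iff₀ (by positivity)]
    refine habs.trans_eq ?_
    field_simp
  obtain ⟨hsA, hs1, hs2⟩ := hA (by
    rw [Metric.mem_ball, Real.dist_eq]
    exact hsm.trans_lt hεR : (2 * k - N : ℝ) / N ∈ Metric.ball m ε)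
  rw [lt_div_iff₀ hN0] at hs1
  rw [div_lt_iff₀ hN0] at hs2
  have hk0 : 0 ≤ k := by
    have : (0 : ℝ) < k := by linarith
    exact_mod_cast this.le
  lift k to ℕ using hk0
  rw [Int.cast_natCast] at hk1 hk2 hsA hs2
  refine ⟨k, ?_, hsA, ?_⟩
  · have : (k : ℝ) < N + 1 := by linarith
    exact_mod_cast this
  · rw [sub_sub]
    exact ⟨by linarith, hk1⟩

open Classical in
/-- The indices `k ≤ N` whose level `(2k - N)/N` lies in `A`. -/
def levelsIn (A : Set ℝ) (N : ℕ) : Finset ℕ :=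
  (Finset.range (N + 1)).filter fun k : ℕ => (2 * k - N : ℝ) / N ∈ A

lemma mem_levelsIn {A : Set ℝ} {N k : ℕ} :
    k ∈ levelsIn A N ↔ k < N + 1 ∧ (2 * k - N : ℝ) / N ∈ A := by
  classical
  rw [levelsIn, Finset.mem_filter, Finset.mem_range]

lemma card_levelsIn_le (A : Set ℝ) (N : ℕ) : (levelsIn A N).card ≤ N + 1 := by
  classical
  exact (Finset.card_filter_le _ _).trans_eq (Finset.card_range _)

/-- The magnetization `2k - N`, centred at `Nm` and divided by `σ`. -/
def scaledLevel (N : ℕ) (m σ : ℝ) (k : ℕ) : ℝ := (2 * k - N - N * m) / σ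

lemma eventually_levelWeight_tail_bounds {p : ℕ} {β h m : ℝ} (hβ : 0 < β)
    (hmax : isMaximizer p β h m) (hH : iteratedDeriv 2 (Hfun p β h) m < 0) {A : Set ℝ}
    (hAopen : IsOpen A) (hmA : m ∈ A) (hA : ∀ x ∈ closure A, isMaximizer p β h x → x = m)
    {w : ℝ} (hw : w = √(-iteratedDeriv 2 (Hfun p β h) m)) :
    ∃ C : ℝ, 0 < C ∧ ∃ C' : ℝ, 0 < C' ∧ ∀ᶠ R : ℝ in atTop, ∀ N : ℕ, (N : ℝ) = R ^ 6 →
      ∀ τ : ℝ, τ = 1 ∨ τ = -1 → ∀ x : ℝ, 0 ≤ x → x ≤ C * R →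
        gaussTail x * (1 - C' * (1 + x ^ 3) / R ^ 3) ≤ 2 * w / R ^ 3 *
          ∑ k ∈ levelsIn A N with x < τ * scaledLevel N m (R ^ 3 / w) k,
            levelWeight p N β h k * Real.exp (-logPeak p N β h m) ∧
        2 * w / R ^ 3 *
          ∑ k ∈ levelsIn A N with x ≤ τ * scaledLevel N m (R ^ 3 / w) k,
            levelWeight p N β h k * Real.exp (-logPeak p N β h m) ≤
          gaussTail x * (1 + C' * (1 + x ^ 3) / R ^ 3) := by
  have hw0 : 0 < w := hw ▸ Real.sqrt_pos.2 (by linarith)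
  obtain ⟨c, hc, hfar⟩ := exists_Hfun_le_sub_sq hβ hmax hH hA
  obtain ⟨D, hD, hnear⟩ := abs_levelWeight_sub_gauss_le hmax hH
  obtain ⟨ε, hε, hball⟩ := Metric.isOpen_iff.1 (hAopen.inter isOpen_Ioo) m ⟨hmA, hmax.1⟩
  obtain ⟨C, hC, C', hC', hbounds⟩ := moderate_tail_bounds hD (κ := 2 * w) (by positivity)
    (c := 4 * c / w ^ 2) (by positivity) (E := 2) two_pos
  refine ⟨C, hC, C', hC', ?_⟩
  filter_upwards [hbounds, hnear, eventually_ge_atTop 1, eventually_ge_atTop (2 * w),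
    eventually_div_sq_le (a := 2 / w) (half_pos hε)] with R hboundsR hnearR hR hwR hεR N hN τ hτ x
  have hR0 : 0 < R := by linarith
  have hσ : 0 < R ^ 3 / w := by positivity
  have hτ1 : |τ| = 1 := by rcases hτ with rfl | rfl <;> simp
  have hτ2 : τ ^ 2 = 1 := by rcases hτ with rfl | rfl <;> simp
  have hy (k : ℕ) : (2 * k - N - N * m : ℝ) =
      scaledLevel N m (R ^ 3 / w) k * (R ^ 3 / w) := (div_mul_cancel₀ _ hσ.ne').symm
  have habs (z : ℝ) (hz : 0 ≤ τ * z) : |z| = τ * z := by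
    rw [← abs_of_nonneg hz, abs_mul, hτ1, one_mul]
  refine hboundsR _ _ _ ?_ ?_ ?_ ?_ ?_ ?_ x
  · rw [← hN]
    exact_mod_cast card_levelsIn_le A N
  · intro k _
    exact mul_nonneg (mul_nonneg (Nat.cast_nonneg _) (Real.exp_pos _).le) (Real.exp_pos _).le
  · intro i _ j _ hij
    have h1 : τ * scaledLevel N m (R ^ 3 / w) i - τ * scaledLevel N m (R ^ 3 / w) j =
        τ * (2 * w / R ^ 3 * ((i : ℤ) - (j : ℤ) : ℤ)) := by
      rw [scaledLevel, scaledLevel]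
      push_cast
      field_simp
      ring
    have h2 : (1 : ℝ) ≤ |(((i : ℤ) - (j : ℤ) : ℤ) : ℝ)| := by
      rw [← Int.cast_abs]
      exact Int.cast_one (R := ℝ) ▸ Int.cast_le.2
        (Int.one_le_abs (sub_ne_zero.2 (Nat.cast_injective.ne hij)))
    have h3 : 0 < 2 * w / R ^ 3 := by positivity
    rw [h1, abs_mul, abs_mul, hτ1, one_mul, abs_of_pos h3]
    exact le_mul_of_one_le_right h3.le h2
  · intro t ht
    obtain ⟨k, hk, hkA, hkt⟩ := exists_level_covering hball hw0 hR hwR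
      (hεR.trans_lt (half_lt_self hε)) hN hτ ht
    exact ⟨k, mem_levelsIn.2 ⟨hk, hkA⟩, hkt⟩
  · intro k _ hk0 hk2
    have := hnearR N k hN (scaledLevel N m (R ^ 3 / w) k) (by rwa [habs _ hk0])
      (by rw [← hw]; exact hy k)
    rw [habs _ hk0] at this
    rwa [mul_pow τ _ 2, hτ2, one_mul]
  · intro k hk hk2
    obtain ⟨hkN, hkA⟩ := mem_levelsIn.1 hk
    refine levelWeight_le_of_far hmax.1 hc hw0 hR0 hfar hN
      (Nat.lt_succ_iff.1 hkN) hkA ?_ (hy k)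
    rw [habs _ (by linarith)]
    exact hk2.le

lemma abs_div_sub_one_le {a b e e' : ℝ} (ha : |a - 1| ≤ e) (hb : |b - 1| ≤ e')
    (he' : e' ≤ 1 / 2) : |a / b - 1| ≤ 2 * (e + e') := by
  rw [abs_le] at ha hb
  have hb0 : 1 / 2 ≤ b := by linarith
  have he : 0 ≤ e + e' := by linarith
  rw [div_sub_one (by linarith), abs_le, le_div_iff₀ (by linarith), div_le_iff₀ (by linarith)]
  constructor <;> nlinarith

lemma eventually_levelWeight_ratio_bound {p : ℕ} {β h m : ℝ} (hβ : 0 < β)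
    (hmax : isMaximizer p β h m) (hH : iteratedDeriv 2 (Hfun p β h) m < 0) {A : Set ℝ}
    (hAopen : IsOpen A) (hmA : m ∈ A) (hA : ∀ x ∈ closure A, isMaximizer p β h x → x = m)
    {w : ℝ} (hw : w = √(-iteratedDeriv 2 (Hfun p β h) m)) :
    ∃ C : ℝ, 0 < C ∧ ∃ C' : ℝ, 0 < C' ∧ ∀ᶠ R : ℝ in atTop, ∀ N : ℕ, (N : ℝ) = R ^ 6 →
      ∀ τ : ℝ, τ = 1 ∨ τ = -1 → ∀ x : ℝ, 0 ≤ x → x ≤ C * R →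
        |(∑ k ∈ levelsIn A N with x < τ * scaledLevel N m (R ^ 3 / w) k, levelWeight p N β h k) /
            (∑ k ∈ levelsIn A N, levelWeight p N β h k) / (1 - stdNormCDF x) - 1| ≤
          C' * (1 + x ^ 3) / R ^ 3 := by
  obtain ⟨C, hC, C', hC', hbounds⟩ :=
    eventually_levelWeight_tail_bounds hβ hmax hH hAopen hmA hA hw
  have hw0 : 0 < w := hw ▸ Real.sqrt_pos.2 (by linarith)
  refine ⟨C, hC, 4 * C', by positivity, ?_⟩
  filter_upwards [hbounds, eventually_ge_atTop 1, eventually_ge_atTop (2 * C')]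
    with R hboundsR hR hRC' N hN τ hτ x hx hxR
  have hR0 : 0 < R := by linarith
  have hκ : 0 < 2 * w / R ^ 3 := by positivity
  have hπ : 0 < √(2 * π) := by positivity
  obtain ⟨f, hf⟩ : ∃ f : ℕ → ℝ, ∀ k, f k =
    levelWeight p N β h k * Real.exp (-logPeak p N β h m) := ⟨_, fun _ => rfl⟩
  have hf0 (k : ℕ) : 0 ≤ f k := by
    rw [hf]
    exact mul_nonneg (mul_nonneg (Nat.cast_nonneg _) (Real.exp_pos _).le) (Real.exp_pos _).le
  have hsum (s : Finset ℕ) : ∑ k ∈ s, levelWeight p N β h k =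
      (∑ k ∈ s, f k) * Real.exp (logPeak p N β h m) := by
    simp_rw [hf, ← Finset.sum_mul]
    rw [mul_assoc, ← Real.exp_add, neg_add_cancel, Real.exp_zero, mul_one]
  have hboundsN := hboundsR N hN
  simp_rw [← hf] at hboundsN
  have hmono (x τ : ℝ) : ∑ k ∈ levelsIn A N with x < τ * scaledLevel N m (R ^ 3 / w) k, f k ≤
      ∑ k ∈ levelsIn A N with x ≤ τ * scaledLevel N m (R ^ 3 / w) k, f k :=
    Finset.sum_le_sum_of_subset_of_nonneg
      (Finset.monotone_filter_right _ fun k _ hk => le_of_lt hk) fun k _ _ => hf0 k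
  have hsplit : ∑ k ∈ levelsIn A N, f k =
      ∑ k ∈ levelsIn A N with 0 < 1 * scaledLevel N m (R ^ 3 / w) k, f k +
        ∑ k ∈ levelsIn A N with 0 ≤ -1 * scaledLevel N m (R ^ 3 / w) k, f k := by
    rw [← Finset.sum_filter_add_sum_filter_not _
      (fun k => 0 < 1 * scaledLevel N m (R ^ 3 / w) k)]
    congr 2
    ext k
    simp
  obtain ⟨T, hT⟩ : ∃ T, T = 2 * w / R ^ 3 *
    ∑ k ∈ levelsIn A N with x < τ * scaledLevel N m (R ^ 3 / w) k, f k := ⟨_, rfl⟩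
  obtain ⟨Z, hZ⟩ : ∃ Z, Z = 2 * w / R ^ 3 * ∑ k ∈ levelsIn A N, f k := ⟨_, rfl⟩
  have hratio : (∑ k ∈ levelsIn A N with x < τ * scaledLevel N m (R ^ 3 / w) k,
      levelWeight p N β h k) / (∑ k ∈ levelsIn A N, levelWeight p N β h k) /
      (1 - stdNormCDF x) = T / gaussTail x / (Z / √(2 * π)) := by
    rw [hsum, hsum, mul_div_mul_right _ _ (Real.exp_pos _).ne', one_sub_stdNormCDF, hT, hZ,
      div_div_div_comm (2 * w / R ^ 3 * _) _ _ _, mul_div_mul_left _ _ hκ.ne']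
  have hG := gaussTail_pos hx
  have hTb : |T / gaussTail x - 1| ≤ C' * (1 + x ^ 3) / R ^ 3 := by
    obtain ⟨h1, h2⟩ := hboundsN τ hτ x hx hxR
    have h3 := (mul_le_mul_of_nonneg_left (hmono x τ) hκ.le).trans h2
    rw [← hT] at h1 h3
    rw [div_sub_one hG.ne', abs_div, abs_of_pos hG, div_le_iff₀ hG, abs_le]
    constructor <;> linarith
  have hZb : |Z / √(2 * π) - 1| ≤ C' / R ^ 3 := by
    obtain ⟨h1, h2⟩ := hboundsN 1 (.inl rfl) 0 le_rfl (by positivity)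
    obtain ⟨h3, h4⟩ := hboundsN (-1) (.inr rfl) 0 le_rfl (by positivity)
    have h5 := mul_le_mul_of_nonneg_left (hmono 0 1) hκ.le
    have h6 := mul_le_mul_of_nonneg_left (hmono 0 (-1)) hκ.le
    rw [hsplit, mul_add] at hZ
    rw [gaussTail_zero, zero_pow three_ne_zero, add_zero, mul_one] at h1 h2 h3 h4
    rw [div_sub_one hπ.ne', abs_div, abs_of_pos hπ, div_le_iff₀ hπ, abs_le]
    constructor <;> linarith
  have hhalf : C' / R ^ 3 ≤ 1 / 2 := by
    rw [div_le_iff₀ (by positivity)]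
    have : R ≤ R ^ 3 := le_self_pow₀ hR three_ne_zero
    linarith
  rw [hratio]
  refine (abs_div_sub_one_le hTb hZb hhalf).trans ?_
  have hle : C' / R ^ 3 ≤ C' * (1 + x ^ 3) / R ^ 3 := by
    gcongr
    exact le_mul_of_one_le_right hC'.le (by linarith [pow_nonneg hx 3])
  calc 2 * (C' * (1 + x ^ 3) / R ^ 3 + C' / R ^ 3)
      ≤ 2 * (C' * (1 + x ^ 3) / R ^ 3 + C' * (1 + x ^ 3) / R ^ 3) := by gcongr
    _ = _ := by ring

lemma cwCondProb_eq_levelWeight_ratio {p N : ℕ} (hN : 0 < N) (β h m τ σ x : ℝ) (A : Set ℝ) :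
    cwCondProb p N β h {ω | τ * (mag ω - N * m) / σ > x} {ω | mag ω / N ∈ A} =
      (∑ k ∈ levelsIn A N with x < τ * scaledLevel N m σ k, levelWeight p N β h k) /
        ∑ k ∈ levelsIn A N, levelWeight p N β h k := by
  classical
  rw [cwCondProb_eq hN β h (fun t => τ * (t - N * m) / σ > x) (fun t => t / N ∈ A)]
  congr 2
  ext k
  rw [Finset.mem_filter, Finset.mem_filter, mem_levelsIn, Finset.mem_range, scaledLevel,
    ← mul_div_assoc]
  tauto

/-- **Moderate deviations at `p`-critical points.** -/
theorem moderate_deviation_critical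
    (p : ℕ) (hp : 3 ≤ p) (β h m : ℝ) (hβ : 0 < β) (hh : 0 < h)
    (hcrit : pCritical p β h) (hmax : isMaximizer p β h m)
    (hH'' : iteratedDeriv 2 (Hfun p β h) m < 0)
    (A : Set ℝ) (hAopen : IsOpen A) (hmA : m ∈ A)
    (hAuniq : ∀ x ∈ closure A, isMaximizer p β h x → x = m) :
    ∃ C : ℝ, 0 < C ∧ ∃ C' : ℝ, 0 < C' ∧ ∃ N₀ : ℕ,
      ∀ N : ℕ, N₀ ≤ N → ∀ r ∈ ({0, 1} : Set ℕ), ∀ x : ℝ,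
        0 ≤ x → x ≤ C * (N : ℝ) ^ ((1:ℝ)/6) →
        |cwCondProb p N β h
            {σ | (-1 : ℝ) ^ r * (mag σ - N * m) /
                Real.sqrt (-(N : ℝ) / iteratedDeriv 2 (Hfun p β h) m) > x}
            {σ | mag σ / N ∈ A} /
            (1 - stdNormCDF x) - 1|
          ≤ C' * (1 + x ^ 3) * (N : ℝ) ^ (-(1:ℝ)/2) := by
  obtain ⟨C, hC, C', hC', hratio⟩ :=
    eventually_levelWeight_ratio_bound hβ hmax hH'' hAopen hmA hAuniq rfl
  have hlim : Tendsto (fun N : ℕ => (N : ℝ) ^ ((1 : ℝ) / 6)) atTop atTop :=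
    (tendsto_rpow_atTop (by norm_num)).comp tendsto_natCast_atTop_atTop
  obtain ⟨N₀, hN₀⟩ := eventually_atTop.1 (hlim.eventually hratio)
  refine ⟨C, hC, C', hC', max N₀ 1, fun N hN r hr x hx hxR => ?_⟩
  have hN1 : 0 < N := (le_max_right N₀ 1).trans hN
  have hR6 : (N : ℝ) = ((N : ℝ) ^ ((1 : ℝ) / 6)) ^ 6 := by
    rw [← Real.rpow_natCast, ← Real.rpow_mul (Nat.cast_nonneg N)]
    norm_num
  have hR3 : √(N : ℝ) = ((N : ℝ) ^ ((1 : ℝ) / 6)) ^ 3 := by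
    rw [Real.sqrt_eq_rpow, ← Real.rpow_natCast, ← Real.rpow_mul (Nat.cast_nonneg N)]
    norm_num
  have hpow : (N : ℝ) ^ (-(1 : ℝ) / 2) = (√(N : ℝ))⁻¹ := by
    rw [Real.sqrt_eq_rpow, ← Real.rpow_neg (Nat.cast_nonneg N), neg_div]
  have hτ : (-1 : ℝ) ^ r = 1 ∨ (-1 : ℝ) ^ r = -1 := neg_one_pow_eq_or ℝ r
  have hσ : √(-(N : ℝ) / iteratedDeriv 2 (Hfun p β h) m) =
      ((N : ℝ) ^ ((1 : ℝ) / 6)) ^ 3 / √(-iteratedDeriv 2 (Hfun p β h) m) := by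
    rw [neg_div, ← div_neg, Real.sqrt_div (Nat.cast_nonneg N), hR3]
  rw [cwCondProb_eq_levelWeight_ratio hN1, hσ, hpow, hR3, ← div_eq_mul_inv]
  exact hN₀ N ((le_max_left N₀ 1).trans hN) N hR6 _ hτ x hx hxR
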